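/- arXiv:1306.2450 — 6 statements merged into one kernel-verified Lean document; each statement's English description precedes it below -/
import Mathlib

section
/- Let p₀ ∈ ℂ and let (λ̃ₙ)_{n∈ℤ∖{0}} be a sequence of complex numbers with Σ_{n≠0}|λ̃ₙ|² < ∞. Set λₙ = πn + p₀ + λ̃ₙ and assume λₙ ≠ 0 for all n ∈ ℤ∖{0}. Then the principal value product ∏_{n∈ℤ∖{0}} λₙ/(πn), i.e., the limit as N → ∞ of the symmetric partial products ∏_{0<|n|≤N} λₙ/(πn), exists and is a nonzero complex number. -/
open Real Filter

theorem Finset.prod_Icc_neg_erase_zero {M : Type*} [CommMonoid M] (g : ℤ → M) (N : ℕ) :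
    ∏ n ∈ (Finset.Icc (-(N : ℤ)) (N : ℤ)).erase 0, g n =
      ∏ k ∈ Finset.range N, g (k + 1) * g (-(k + 1)) := by
  induction N with
  | zero => simp
  | succ N ih =>
    have h : (Finset.Icc (-((N + 1 : ℕ) : ℤ)) ((N + 1 : ℕ) : ℤ)).erase 0 =
        insert ((N : ℤ) + 1) (insert (-((N : ℤ) + 1))
          ((Finset.Icc (-(N : ℤ)) (N : ℤ)).erase 0)) := by
      ext x
      simp only [Finset.mem_erase, Finset.mem_Icc, Finset.mem_insert]
      omega
    rw [h, Finset.prod_insert, Finset.prod_insert, ih, Finset.prod_range_succ]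
    · ac_rfl
    all_goals
      simp only [Finset.mem_erase, Finset.mem_Icc, Finset.mem_insert]
      omega

theorem norm_sub_mul_sub_mul_sq_le (p a b u : ℂ) (hu : ‖u‖ ≤ 1) :
    ‖(a - b) * u - (p + a) * (p + b) * u ^ 2‖ ≤
      3 * ‖a‖ ^ 2 + 3 * ‖b‖ ^ 2 + (2 + 4 * ‖p‖ ^ 2) * ‖u‖ ^ 2 := by
  have h₁ : ‖(a - b) * u‖ ≤ (‖a‖ + ‖b‖) * ‖u‖ := by
    rw [norm_mul]
    gcongr
    exact norm_sub_le a b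
  have h₂ : ‖(p + a) * (p + b) * u ^ 2‖ ≤ (‖p‖ + ‖a‖) * (‖p‖ + ‖b‖) * ‖u‖ ^ 2 := by
    rw [norm_mul, norm_mul, norm_pow]
    gcongr <;> exact norm_add_le _ _
  have h₃ : (‖p‖ + ‖a‖) * (‖p‖ + ‖b‖) ≤ 2 * ‖p‖ ^ 2 + (‖a‖ ^ 2 + ‖b‖ ^ 2) := by
    nlinarith [sq_nonneg (‖p‖ - ‖a‖), sq_nonneg (‖p‖ - ‖b‖), sq_nonneg (‖a‖ - ‖b‖)]
  have h₄ : (‖a‖ ^ 2 + ‖b‖ ^ 2) * ‖u‖ ^ 2 ≤ ‖a‖ ^ 2 + ‖b‖ ^ 2 :=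
    mul_le_of_le_one_right (by positivity) (pow_le_one₀ (norm_nonneg u) hu)
  have h₅ := mul_le_mul_of_nonneg_right h₃ (sq_nonneg ‖u‖)
  nlinarith [norm_sub_le ((a - b) * u) ((p + a) * (p + b) * u ^ 2), sq_nonneg (‖a‖ - ‖u‖),
    sq_nonneg (‖b‖ - ‖u‖), sq_nonneg ‖a‖, sq_nonneg ‖b‖, sq_nonneg ‖u‖,
    mul_nonneg (sq_nonneg ‖p‖) (sq_nonneg ‖u‖)]

/-- Lemma 4.3: if `λₙ = πn + p₀ + λ̃ₙ` with `(λ̃ₙ)_{n∈ℤ∖{0}} ∈ ℓ²` and all `λₙ ≠ 0`, then the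
principal-value product `∏_{n∈ℤ∖{0}} λₙ/(πn)` (the limit of the symmetric partial products
over `0 < |n| ≤ N`) exists and is a nonzero complex number. -/
theorem pv_product_convergent
    (p₀ : ℂ) (tl : ℤ → ℂ)
    (htl : Summable (fun n : {n : ℤ // n ≠ 0} => ‖tl n‖ ^ 2))
    (lam : ℤ → ℂ)
    (hlam : ∀ n : ℤ, n ≠ 0 → lam n = (π : ℂ) * n + p₀ + tl n)
    (hne : ∀ n : ℤ, n ≠ 0 → lam n ≠ 0) :
    ∃ L : ℂ, L ≠ 0 ∧
      Tendsto (fun N : ℕ =>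
          ∏ n ∈ (Finset.Icc (-(N:ℤ)) (N:ℤ)).erase 0, lam n / ((π : ℂ) * n))
        atTop (nhds L) := by
  have hπ : (π : ℂ) ≠ 0 := mod_cast pi_ne_zero
  have hk (k : ℕ) : (k : ℂ) + 1 ≠ 0 := mod_cast k.succ_ne_zero
  have hk' (k : ℕ) : (k : ℤ) + 1 ≠ 0 := by omega
  set u : ℕ → ℂ := fun k => ((π : ℂ) * (k + 1))⁻¹ with hu
  have hu_norm (k : ℕ) : ‖u k‖ = (π * ((k : ℝ) + 1))⁻¹ := by
    rw [hu, norm_inv, norm_mul, Complex.norm_of_nonneg pi_pos.le, ← Nat.cast_succ,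
      Complex.norm_natCast, Nat.cast_succ]
  have hu_le (k : ℕ) : ‖u k‖ ≤ 1 := by
    rw [hu_norm]
    refine inv_le_one_of_one_le₀ ?_
    nlinarith [pi_gt_three, (Nat.cast_nonneg k : (0 : ℝ) ≤ k)]
  have hu_sum : Summable fun k => ‖u k‖ ^ 2 := by
    have h := ((summable_nat_add_iff (f := fun n : ℕ => ((n : ℝ) ^ 2)⁻¹) 1).mpr
      (Real.summable_nat_pow_inv.mpr one_lt_two)).mul_left (π ^ 2)⁻¹
    refine h.congr fun k => ?_
    rw [hu_norm, inv_pow, mul_pow, mul_inv, Nat.cast_succ]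
  have htl_comp {e : ℕ → ℤ} (he : Function.Injective e) (he₀ : ∀ k, e k ≠ 0) :
      Summable fun k => ‖tl (e k)‖ ^ 2 := by
    have hi : Function.Injective fun k => (⟨e k, he₀ k⟩ : {n : ℤ // n ≠ 0}) :=
      fun i j h => he (congrArg Subtype.val h)
    have h := htl.comp_injective hi
    exact h
  have ha : Summable fun k : ℕ => ‖tl (k + 1)‖ ^ 2 :=
    htl_comp (e := fun k => (k : ℤ) + 1) (fun i j h => by simpa using h) hk'
  have hb : Summable fun k : ℕ => ‖tl (-(k + 1))‖ ^ 2 :=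
    htl_comp (e := fun k => -((k : ℤ) + 1)) (fun i j h => by simpa using h)
      fun k => neg_ne_zero.mpr (hk' k)
  set f : ℕ → ℂ := fun k => (tl (k + 1) - tl (-(k + 1))) * u k -
    (p₀ + tl (k + 1)) * (p₀ + tl (-(k + 1))) * u k ^ 2 with hf
  have hf_sum : Summable fun k => ‖f k‖ :=
    (((ha.mul_left 3).add (hb.mul_left 3)).add (hu_sum.mul_left (2 + 4 * ‖p₀‖ ^ 2))).of_nonneg_of_le
      (fun _ => norm_nonneg _) fun k => norm_sub_mul_sub_mul_sq_le _ _ _ _ (hu_le k)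
  set g : ℤ → ℂ := fun n => lam n / ((π : ℂ) * n) with hg
  have hg_ne {n : ℤ} (hn : n ≠ 0) : g n ≠ 0 :=
    div_ne_zero (hne n hn) (mul_ne_zero hπ (Int.cast_ne_zero.mpr hn))
  have hfg (k : ℕ) : g (k + 1) * g (-(k + 1)) = 1 + f k := by
    have := hk k
    simp only [hg, hf, hu, hlam _ (hk' k), hlam _ (neg_ne_zero.mpr (hk' k))]
    push_cast
    generalize tl (-(↑k + 1)) = b
    generalize tl (↑k + 1) = a
    field_simp
    ring
  have hf_ne (k : ℕ) : 1 + f k ≠ 0 := by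
    rw [← hfg]
    exact mul_ne_zero (hg_ne (hk' k)) (hg_ne (neg_ne_zero.mpr (hk' k)))
  refine ⟨∏' k, (1 + f k), tprod_one_add_ne_zero_of_summable hf_ne hf_sum, ?_⟩
  simp_rw [Finset.prod_Icc_neg_erase_zero g, hfg]
  exact (multipliable_one_add_of_summable hf_sum).hasProd.tendsto_prod_nat
end

section
/- Let p₀ ∈ ℂ and let (λ̃ₙ)_{n∈ℤ∖{0}} be a sequence of complex numbers with Σ_{n≠0}|λ̃ₙ|² < ∞. Set νₙ = πn + p₀ and λₙ = νₙ + λ̃ₙ, and fix θ ∈ (0,2π) with θ ≠ π. Then there exists R > 0 such that for every r > R all the numbers νₙ − re^{iθ} are nonzero and the product ∏_{n∈ℤ∖{0}} (λₙ − re^{iθ})/(νₙ − re^{iθ}) converges absolutely; moreover the value of this product tends to 1 as r → ∞. -/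
open Real Filter Complex

/-- A ray `r e^{iθ}` with `|cos θ| < 1` stays linearly far from the real axis. -/
theorem exists_pos_mul_le_norm_ofReal_sub_mul_exp {θ : ℝ} (h : |Real.cos θ| < 1) :
    ∃ c : ℝ, 0 < c ∧ ∀ x r : ℝ, 0 ≤ r →
      c * (|x| + r) ≤ ‖(x : ℂ) - r * Complex.exp (θ * I)‖ := by
  have hpos : 0 < (1 - |Real.cos θ|) / 2 := by linarith
  refine ⟨√((1 - |Real.cos θ|) / 2), Real.sqrt_pos.2 hpos, fun x r hr => ?_⟩
  refine le_of_sq_le_sq ?_ (norm_nonneg _)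
  have hnorm : ‖(x : ℂ) - r * Complex.exp (θ * I)‖ ^ 2
      = x ^ 2 - 2 * (x * r * Real.cos θ) + r ^ 2 := by
    rw [Complex.sq_norm, Complex.normSq_apply]
    simp only [sub_re, sub_im, mul_re, mul_im, ofReal_re, ofReal_im, exp_ofReal_mul_I_re,
      exp_ofReal_mul_I_im]
    linear_combination r ^ 2 * Real.sin_sq_add_cos_sq θ
  rw [hnorm, mul_pow, Real.sq_sqrt hpos.le]
  have hle : x * r * Real.cos θ ≤ |x| * r * |Real.cos θ| := by
    refine (le_abs_self _).trans_eq ?_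
    rw [abs_mul, abs_mul, abs_of_nonneg hr]
  rw [← sq_abs x]
  nlinarith [mul_nonneg (abs_nonneg (Real.cos θ)) (sq_nonneg (|x| - r)),
    mul_nonneg (sub_nonneg.2 h.le) (sq_nonneg (|x| - r)), sq_nonneg (|x| - r)]

/-- The points `πn + p₀` are eventually linearly far from a non-real ray, uniformly in `n`. -/
theorem exists_pos_mul_le_norm_pi_mul_int_add_sub {θ : ℝ} (h : |Real.cos θ| < 1) (p₀ : ℂ) :
    ∃ c R : ℝ, 0 < c ∧ 0 < R ∧ ∀ r : ℝ, R < r → ∀ n : ℤ,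
      c * (|(n : ℝ)| + r) ≤ ‖(π : ℂ) * n + p₀ - r * Complex.exp (θ * I)‖ := by
  obtain ⟨c, hc, hle⟩ := exists_pos_mul_le_norm_ofReal_sub_mul_exp h
  refine ⟨c / 2, 2 * ‖p₀‖ / c + 1, by positivity, by positivity, fun r hr n => ?_⟩
  have hr0 : 0 < r := lt_trans (by positivity) hr
  have hp : 2 * ‖p₀‖ ≤ c * r := by
    rw [← div_le_iff₀' hc]
    linarith
  have hray := hle (π * n) r hr0.le
  rw [abs_mul, abs_of_pos Real.pi_pos] at hray
  have hn : |(n : ℝ)| ≤ π * |(n : ℝ)| :=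
    le_mul_of_one_le_left (abs_nonneg _) (by linarith [Real.pi_gt_three])
  have hcn := mul_le_mul_of_nonneg_left hn hc.le
  have htri : ‖((π * n : ℝ) : ℂ) - r * Complex.exp (θ * I)‖ - ‖p₀‖
      ≤ ‖(π : ℂ) * n + p₀ - r * Complex.exp (θ * I)‖ := by
    rw [show (π : ℂ) * n + p₀ - r * Complex.exp (θ * I)
      = (((π * n : ℝ) : ℂ) - r * Complex.exp (θ * I)) + p₀ by push_cast; ring]
    linarith [norm_le_add_norm_add (((π * n : ℝ) : ℂ) - r * Complex.exp (θ * I)) p₀]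
  nlinarith [mul_nonneg hc.le (abs_nonneg (n : ℝ))]

/-- Lemma 4.4: with `νₙ = πn + p₀`, `λₙ = νₙ + λ̃ₙ`, `(λ̃ₙ) ∈ ℓ²`, and a fixed direction
`θ ∈ (0,2π) ∖ {π}`, there is `R > 0` such that for `r > R` all `νₙ − re^{iθ}` are nonzero and
the product `∏_{n∈ℤ∖{0}} (λₙ − re^{iθ})/(νₙ − re^{iθ})` converges absolutely; moreover its
value tends to `1` as `r → ∞`. -/
theorem ratio_product_tendsto_one
    (p₀ : ℂ) (tl : ℤ → ℂ)
    (htl : Summable (fun n : {n : ℤ // n ≠ 0} => ‖tl n‖ ^ 2))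
    (θ : ℝ) (hθ : θ ∈ Set.Ioo 0 (2 * π)) (hθπ : θ ≠ π) :
    ∃ R : ℝ, 0 < R ∧
      (∀ r : ℝ, R < r →
        (∀ n : ℤ, n ≠ 0 → ((π : ℂ) * n + p₀) - r * Complex.exp (θ * I) ≠ 0) ∧
        Summable (fun n : {n : ℤ // n ≠ 0} =>
          ‖((π : ℂ) * (n : ℤ) + p₀ + tl n - r * Complex.exp (θ * I)) /
              ((π : ℂ) * (n : ℤ) + p₀ - r * Complex.exp (θ * I)) - 1‖)) ∧
      Tendsto (fun r : ℝ =>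
          ∏' n : {n : ℤ // n ≠ 0},
            ((π : ℂ) * (n : ℤ) + p₀ + tl n - r * Complex.exp (θ * I)) /
              ((π : ℂ) * (n : ℤ) + p₀ - r * Complex.exp (θ * I)))
        atTop (nhds 1) := by
  have hcos : |Real.cos θ| < 1 := by
    have hsin : Real.sin θ ≠ 0 := by
      rcases lt_or_gt_of_ne hθπ with hlt | hgt
      · exact (Real.sin_pos_of_pos_of_lt_pi hθ.1 hlt).ne'
      · have hneg := Real.sin_neg_of_neg_of_neg_pi_lt (x := θ - 2 * π) (by linarith [hθ.2])
          (by linarith)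
        rw [Real.sin_sub_two_pi] at hneg
        exact hneg.ne
    rw [← sq_lt_one_iff_abs_lt_one]
    linarith [Real.sin_sq_add_cos_sq θ, pow_pos (abs_pos.2 hsin) 2, sq_abs (Real.sin θ)]
  obtain ⟨c, R, hc, hR, hle⟩ := exists_pos_mul_le_norm_pi_mul_int_add_sub hcos p₀
  have hne (r : ℝ) (hr : R < r) (n : ℤ) :
      (π : ℂ) * n + p₀ - r * Complex.exp (θ * I) ≠ 0 := by
    have hr0 : 0 < r := hR.trans hr
    exact norm_pos_iff.1 (lt_of_lt_of_le (by positivity) (hle r hr n))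
  set f : ℝ → {n : ℤ // n ≠ 0} → ℂ := fun r n =>
    ((π : ℂ) * (n : ℤ) + p₀ + tl n - r * Complex.exp (θ * I)) /
      ((π : ℂ) * (n : ℤ) + p₀ - r * Complex.exp (θ * I)) - 1 with hf
  have hnorm (r : ℝ) (hr : R < r) (n : {n : ℤ // n ≠ 0}) :
      ‖f r n‖ ≤ ‖tl n‖ / (c * (|((n : ℤ) : ℝ)| + r)) := by
    have hr0 : 0 < r := hR.trans hr
    have hfn : f r n = tl n / ((π : ℂ) * (n : ℤ) + p₀ - r * Complex.exp (θ * I)) := by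
      have hn := hne r hr n
      simp only [hf]
      rw [div_sub_one hn]
      congr 1
      ring
    rw [hfn, norm_div]
    exact div_le_div_of_nonneg_left (norm_nonneg _) (by positivity) (hle r hr n)
  set bound : {n : ℤ // n ≠ 0} → ℝ := fun n =>
    (‖tl n‖ ^ 2 + 1 / ((n : ℤ) : ℝ) ^ 2) / c with hbound
  have hsum : Summable bound :=
    (htl.add ((Real.summable_one_div_int_pow.2 one_lt_two).subtype _)).div_const c
  have hfb (r : ℝ) (hr : R < r) (n : {n : ℤ // n ≠ 0}) : ‖f r n‖ ≤ bound n := by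
    have hr0 : 0 < r := hR.trans hr
    have hn : 0 < |((n : ℤ) : ℝ)| := abs_pos.2 (Int.cast_ne_zero.2 n.2)
    calc ‖f r n‖ ≤ ‖tl n‖ / (c * (|((n : ℤ) : ℝ)| + r)) := hnorm r hr n
      _ ≤ ‖tl n‖ / (c * |((n : ℤ) : ℝ)|) := by gcongr; linarith
      _ = ‖tl n‖ * |((n : ℤ) : ℝ)|⁻¹ / c := by field_simp
      _ ≤ bound n := by
        simp only [hbound]
        rw [← sq_abs ((n : ℤ) : ℝ), one_div, ← inv_pow]
        gcongr
        nlinarith [sq_nonneg (‖tl n‖ - |((n : ℤ) : ℝ)|⁻¹), sq_nonneg ‖tl n‖,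
          sq_nonneg (|((n : ℤ) : ℝ)|⁻¹)]
  refine ⟨R, hR, fun r hr => ⟨fun n _ => hne r hr n,
    hsum.of_nonneg_of_le (fun _ => norm_nonneg _) (hfb r hr)⟩, ?_⟩
  have hlim (n : {n : ℤ // n ≠ 0}) : Tendsto (f · n) atTop (nhds 0) := by
    refine squeeze_zero_norm' (a := fun r => ‖tl n‖ / c / r) ?_ (tendsto_id.const_div_atTop _)
    filter_upwards [eventually_gt_atTop R] with r hr
    have hr0 : 0 < r := hR.trans hr
    refine (hnorm r hr n).trans ?_
    rw [div_div]
    gcongr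
    linarith [abs_nonneg ((n : ℤ) : ℝ)]
  have hmain := tendsto_tprod_one_add_of_dominated_convergence (g := 0) hsum hlim
    ((eventually_gt_atTop R).mono hfb)
  simpa [hf] using hmain
end

section
/- Let p₀ ∈ ℂ with p₀ ∉ π/2 + πℤ, and let ψ : ℂ → ℂ be an entire function of finite exponential type (i.e., |ψ(z)| ≤ C e^{σ|z|} for some constants C, σ ≥ 0) such that ψ(0) ≠ 0 and, for every θ ∈ (0,2π) with θ ≠ π, ψ(re^{iθ})/cos(re^{iθ} − p₀) → 1 as r → +∞. Assume the zeros of ψ, counted with multiplicity, are enumerated by a sequence (μₙ)_{n∈ℤ} (i.e., for every z ∈ ℂ the order of vanishing of ψ at z equals the number of indices n with μₙ = z) satisfying μₙ = π(n + 1/2) + p₀ + μ̃ₙ with Σ_{n∈ℤ}|μ̃ₙ|² < ∞. Then for every μ ∈ ℂ, ψ(μ) = lim_{N→∞} ∏_{n=−N−1}^{N} (μₙ − μ)/(π(n + 1/2)). (This is the factorization of the characteristic function of the mixed problem; note that the stated sign, verified on the model ψ(μ) = cos(μ − p₀), corrects an apparent sign slip in the paper's formula.) -/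
open Real Filter Complex

/-- `ψ` has a zero of order exactly `m` at `z` (order `0` meaning `ψ(z) ≠ 0`). -/
def ZeroOrder (ψ : ℂ → ℂ) (z : ℂ) (m : ℕ) : Prop :=
  ∃ g : ℂ → ℂ, AnalyticAt ℂ g z ∧ g z ≠ 0 ∧ ∀ᶠ w in nhds z, ψ w = (w - z) ^ m * g w

theorem ZeroOrder.mul {f g : ℂ → ℂ} {z : ℂ} {m n : ℕ} (hf : ZeroOrder f z m)
    (hg : ZeroOrder g z n) : ZeroOrder (fun w => f w * g w) z (m + n) := by
  obtain ⟨a, ha, ha0, hfa⟩ := hf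
  obtain ⟨b, hb, hb0, hgb⟩ := hg
  refine ⟨fun w => a w * b w, ha.mul hb, mul_ne_zero ha0 hb0, ?_⟩
  filter_upwards [hfa, hgb] with w h₁ h₂
  rw [h₁, h₂]
  ring

theorem ZeroOrder.of_ne_zero {f : ℂ → ℂ} {z : ℂ} (hf : AnalyticAt ℂ f z) (h : f z ≠ 0) :
    ZeroOrder f z 0 :=
  ⟨f, hf, h, by simp⟩

theorem ZeroOrder.finset_prod_linear {ι : Type*} [DecidableEq ι] (mu c : ι → ℂ)
    (hc : ∀ i, c i ≠ 0) (z : ℂ) (S : Finset ι) :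
    ZeroOrder (fun w => ∏ i ∈ S, (mu i - w) / c i) z (S.filter (fun i => mu i = z)).card := by
  induction S using Finset.induction_on with
  | empty => simpa using ZeroOrder.of_ne_zero (f := fun _ => 1) analyticAt_const one_ne_zero
  | insert i S hi ih =>
    simp only [Finset.prod_insert hi, Finset.filter_insert]
    by_cases h : mu i = z
    · rw [if_pos h, Finset.card_insert_of_notMem (by simp [hi]), add_comm]
      refine ZeroOrder.mul ⟨fun _ => -1 / c i, analyticAt_const,
        div_ne_zero (by norm_num) (hc i), Eventually.of_forall fun w => ?_⟩ ih
      rw [h]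
      ring
    · rw [if_neg h, ← zero_add (Finset.card _)]
      refine ZeroOrder.mul (ZeroOrder.of_ne_zero ?_ (div_ne_zero (sub_ne_zero.2 h) (hc i))) ih
      exact (analyticAt_const.sub analyticAt_id).div_const

/-- Two entire functions with the same zeros, counted with multiplicity, differ by an entire
factor. -/
theorem exists_differentiable_quotient {f g : ℂ → ℂ} {m : ℂ → ℕ}
    (hf : ∀ z, ZeroOrder f z (m z)) (hg : ∀ z, ZeroOrder g z (m z)) :
    ∃ F : ℂ → ℂ, Differentiable ℂ F ∧ ∀ z, f z = F z * g z := by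
  choose a ha ha0 hfa using hf
  choose b hb hb0 hgb using hg
  have key : ∀ z, (fun w => a w w / b w w) =ᶠ[nhds z] fun w => a z w / b z w := by
    intro z
    filter_upwards [(hfa z).eventually_nhds, (hgb z).eventually_nhds,
      (ha z).continuousAt.eventually_ne (ha0 z), (hb z).continuousAt.eventually_ne (hb0 z)]
      with w h₁ h₂ h₃ h₄
    rcases eq_or_ne w z with rfl | hw
    · rfl
    · have hgw : g w ≠ 0 := by
        rw [h₂.self_of_nhds]
        exact mul_ne_zero (pow_ne_zero _ (sub_ne_zero.2 hw)) h₄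
      have hm : m w = 0 := by
        by_contra hm
        exact hgw (by rw [(hgb w).self_of_nhds]; simp [hm])
      have e₁ := (hfa w).self_of_nhds
      have e₂ := (hgb w).self_of_nhds
      rw [hm, pow_zero, one_mul] at e₁ e₂
      rw [← e₁, ← e₂, h₁.self_of_nhds, h₂.self_of_nhds,
        mul_div_mul_left _ _ (pow_ne_zero _ (sub_ne_zero.2 hw))]
  refine ⟨fun w => a w w / b w w, fun z => ?_, fun z => ?_⟩
  · exact (((ha z).div (hb z) (hb0 z)).differentiableAt).congr_of_eventuallyEq (key z)
  · rw [(hfa z).self_of_nhds, (hgb z).self_of_nhds]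
    field_simp [hb0 z]

theorem differentiable_tprod_one_add {g : ℕ → ℂ → ℂ} (hd : ∀ k, Differentiable ℂ (g k))
    (hb : ∀ R : ℝ, ∃ u : ℕ → ℝ, Summable u ∧ ∀ k z, ‖z‖ < R → ‖g k z‖ ≤ u k) :
    Differentiable ℂ (fun z => ∏' k, (1 + g k z)) := by
  intro z
  obtain ⟨u, hu, hbu⟩ := hb (‖z‖ + 1)
  have h := Summable.hasProdLocallyUniformlyOn_nat_one_add (f := g) (K := Metric.ball 0 (‖z‖ + 1))
    Metric.isOpen_ball hu
    (Eventually.of_forall fun k w hw => hbu k w (by simpa using hw))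
    fun k => (hd k).continuous.continuousOn
  have h' := h.tendstoLocallyUniformlyOn_finsetRange.differentiableOn
    (Eventually.of_forall fun N => by
      apply DifferentiableOn.fun_finsetProd
      exact fun k _ => ((hd k).const_add 1).differentiableOn) Metric.isOpen_ball
  exact h'.differentiableAt (Metric.isOpen_ball.mem_nhds (by simp))

theorem prod_Icc_eq_prod_range_pairs {M : Type*} [CommMonoid M] (f : ℤ → M) (N : ℕ) :
    ∏ n ∈ Finset.Icc (-(N : ℤ) - 1) (N : ℤ), f n =
      ∏ k ∈ Finset.range (N + 1), (f k * f (-(k : ℤ) - 1)) := by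
  induction N with
  | zero =>
    have : Finset.Icc (-((0 : ℕ) : ℤ) - 1) ((0 : ℕ) : ℤ) = {0, -1} := by decide
    rw [this]
    simp
  | succ N ih =>
    have : Finset.Icc (-((N + 1 : ℕ) : ℤ) - 1) ((N + 1 : ℕ) : ℤ) =
        insert ((N + 1 : ℕ) : ℤ) (insert (-((N + 1 : ℕ) : ℤ) - 1)
          (Finset.Icc (-(N : ℤ) - 1) (N : ℤ))) := by
      ext n
      simp only [Finset.mem_Icc, Finset.mem_insert]
      omega
    rw [Finset.prod_range_succ, ← ih, this, Finset.prod_insert, Finset.prod_insert]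
    · rw [mul_comm, ← mul_assoc, mul_comm]
      ac_rfl
    · simp only [Finset.mem_Icc]
      omega
    · simp only [Finset.mem_Icc, Finset.mem_insert]
      omega

/-- The zeros of `cos`. -/
noncomputable def cosZero (n : ℤ) : ℂ := (π : ℂ) * ((n : ℤ) + 1 / 2)

theorem cosZero_eq_ofReal (n : ℤ) : cosZero n = ((π * (n + 1 / 2) : ℝ) : ℂ) := by
  simp [cosZero]

theorem one_le_abs_pi_mul_int_add_half (n : ℤ) : 1 ≤ |π * ((n : ℝ) + 1 / 2)| := by
  rw [abs_mul, abs_of_pos Real.pi_pos]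
  have h : (1 / 2 : ℝ) ≤ |(n : ℝ) + 1 / 2| := by
    rcases le_or_gt 0 n with hn | hn
    · have : (0 : ℝ) ≤ n := by exact_mod_cast hn
      exact le_trans (by linarith) (le_abs_self _)
    · have : (n : ℝ) ≤ -1 := by exact_mod_cast (by omega : n ≤ -1)
      exact le_trans (by linarith) (neg_le_abs _)
  nlinarith [Real.pi_gt_three]

theorem one_le_norm_cosZero (n : ℤ) : 1 ≤ ‖cosZero n‖ := by
  rw [cosZero_eq_ofReal, Complex.norm_real]
  exact one_le_abs_pi_mul_int_add_half n

theorem cosZero_ne_zero (n : ℤ) : cosZero n ≠ 0 :=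
  norm_pos_iff.1 (one_pos.trans_le (one_le_norm_cosZero n))

theorem cosZero_neg_sub_one (n : ℤ) : cosZero (-n - 1) = -cosZero n := by
  simp only [cosZero]
  push_cast
  ring

theorem summable_two_div_one_add_int_sq : Summable fun n : ℤ => 2 / (1 + (n : ℝ) ^ 2) := by
  refine Summable.of_norm_bounded_eventually (g := fun n : ℤ => 2 * (1 / (n : ℝ) ^ 2))
    ((Real.summable_one_div_int_pow.2 one_lt_two).mul_left 2) ?_
  filter_upwards [(Set.finite_singleton (0 : ℤ)).compl_mem_cofinite] with n hn
  have hn' : (n : ℝ) ≠ 0 := by simpa using hn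
  rw [Real.norm_of_nonneg (by positivity), mul_one_div]
  gcongr
  linarith

theorem exists_int_abs_sub_pi_mul_le (x : ℝ) : ∃ m : ℤ, |x - π * (m + 1 / 2)| ≤ π / 2 := by
  refine ⟨round (x / π - 1 / 2), ?_⟩
  have h := abs_sub_round (x / π - 1 / 2)
  have e : x - π * ((round (x / π - 1 / 2) : ℤ) + 1 / 2) =
      π * (x / π - 1 / 2 - (round (x / π - 1 / 2) : ℤ)) := by
    field_simp [Real.pi_ne_zero]
    ring
  rw [e, abs_mul, abs_of_pos Real.pi_pos]
  nlinarith [Real.pi_pos]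

theorem exists_sum_inv_norm_cosZero_sub_sq_le :
    ∃ B : ℝ, 0 ≤ B ∧ ∀ w : ℂ, (∀ n, 1 ≤ ‖cosZero n - w‖) → ∀ S : Finset ℤ,
      ∑ n ∈ S, 1 / ‖cosZero n - w‖ ^ 2 ≤ B := by
  refine ⟨∑' n : ℤ, 2 / (1 + (n : ℝ) ^ 2), tsum_nonneg fun n => by positivity, fun w hw S => ?_⟩
  obtain ⟨m, hm⟩ := exists_int_abs_sub_pi_mul_le w.re
  have key : ∀ n : ℤ, 1 / ‖cosZero n - w‖ ^ 2 ≤ 2 / (1 + ((n - m : ℤ) : ℝ) ^ 2) := by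
    intro n
    have h1 := hw n
    have h2 : |π * ((n : ℝ) + 1 / 2) - w.re| ≤ ‖cosZero n - w‖ := by
      have := Complex.abs_re_le_norm (cosZero n - w)
      rwa [cosZero_eq_ofReal, Complex.sub_re, Complex.ofReal_re, ← cosZero_eq_ofReal] at this
    have h3 : π * |((n - m : ℤ) : ℝ)| ≤ ‖cosZero n - w‖ + π / 2 := by
      calc π * |((n - m : ℤ) : ℝ)| = |π * ((n - m : ℤ) : ℝ)| := by
            rw [abs_mul, abs_of_pos Real.pi_pos]
        _ = |(π * ((n : ℝ) + 1 / 2) - w.re) + (w.re - π * (m + 1 / 2))| := by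
            congr 1
            push_cast
            ring
        _ ≤ _ := (abs_add_le _ _).trans (add_le_add h2 hm)
    have h4 : |((n - m : ℤ) : ℝ)| ≤ ‖cosZero n - w‖ := by
      nlinarith [Real.pi_gt_three]
    rw [div_le_div_iff₀ (by positivity) (by positivity)]
    nlinarith [sq_abs ((n - m : ℤ) : ℝ), abs_nonneg ((n - m : ℤ) : ℝ)]
  have hs : Summable fun n : ℤ => 2 / (1 + ((n - m : ℤ) : ℝ) ^ 2) :=
    (Equiv.subRight m).summable_iff.2 summable_two_div_one_add_int_sq
  calc ∑ n ∈ S, 1 / ‖cosZero n - w‖ ^ 2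
      ≤ ∑ n ∈ S, 2 / (1 + ((n - m : ℤ) : ℝ) ^ 2) := Finset.sum_le_sum fun n _ => key n
    _ ≤ ∑' n : ℤ, 2 / (1 + ((n - m : ℤ) : ℝ) ^ 2) :=
        hs.sum_le_tsum S fun n _ => by positivity
    _ = _ := (Equiv.subRight m).tsum_eq fun n : ℤ => 2 / (1 + (n : ℝ) ^ 2)

theorem summable_inv_norm_cosZero_sq : Summable fun n : ℤ => 1 / ‖cosZero n‖ ^ 2 := by
  obtain ⟨B, -, hB⟩ := exists_sum_inv_norm_cosZero_sub_sq_le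
  refine summable_of_sum_le (c := B) (fun n => by positivity) fun S => ?_
  simpa using hB 0 (by simpa using one_le_norm_cosZero) S

theorem two_div_pi_le_norm_cos {w : ℂ} (hw : ∀ n, 1 ≤ ‖cosZero n - w‖) :
    2 / π ≤ ‖Complex.cos w‖ := by
  obtain ⟨m, hm⟩ := exists_int_abs_sub_pi_mul_le w.re
  set a := w.re - π * (m + 1 / 2) with ha
  have hc : |Real.cos w.re| = |Real.sin a| := by
    rw [show w.re = (a + π / 2) + m * π by rw [ha]; ring, Real.cos_add_int_mul_pi,
      Real.cos_add_pi_div_two, abs_mul, abs_zpow]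
    simp
  have hcos : 2 / π * |a| ≤ |Real.cos w.re| := hc ▸ Real.mul_abs_le_abs_sin hm
  have hsinh : |w.im| ≤ |Real.sinh w.im| := by
    rw [Real.abs_sinh]
    exact Real.self_le_sinh_iff.2 (abs_nonneg _)
  have hpi : 2 / π ≤ 1 := (div_le_one Real.pi_pos).2 (by linarith [Real.pi_gt_three])
  have hpi0 : 0 < 2 / π := by positivity
  have hnorm : ‖Complex.cos w‖ ^ 2 = Real.cos w.re ^ 2 + Real.sinh w.im ^ 2 := by
    rw [Complex.sq_norm, Complex.normSq_apply, Complex.cos_eq]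
    simp only [← Complex.ofReal_cos, ← Complex.ofReal_sin, ← Complex.ofReal_cosh,
      ← Complex.ofReal_sinh, Complex.sub_re, Complex.sub_im, Complex.mul_re, Complex.mul_im,
      Complex.ofReal_re, Complex.ofReal_im, Complex.I_re, Complex.I_im]
    nlinarith [Real.sin_sq_add_cos_sq w.re, Real.cosh_sq w.im]
  have hdist : ‖cosZero m - w‖ ^ 2 = a ^ 2 + w.im ^ 2 := by
    rw [Complex.sq_norm, Complex.normSq_apply, cosZero_eq_ofReal]
    simp only [Complex.sub_re, Complex.sub_im, Complex.ofReal_re, Complex.ofReal_im, ha]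
    ring
  have h1 : 1 ≤ a ^ 2 + w.im ^ 2 := hdist ▸ one_le_pow₀ (hw m)
  have h2 : (2 / π * |a|) ^ 2 ≤ Real.cos w.re ^ 2 := by
    rw [← sq_abs (Real.cos w.re)]
    gcongr
  have h3 : (2 / π * |w.im|) ^ 2 ≤ Real.sinh w.im ^ 2 := by
    rw [← sq_abs (Real.sinh w.im)]
    have : 2 / π * |w.im| ≤ |Real.sinh w.im| := by nlinarith [abs_nonneg w.im]
    gcongr
  refine (sq_le_sq₀ hpi0.le (norm_nonneg _)).1 ?_
  rw [hnorm]
  rw [mul_pow, sq_abs] at h2 h3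
  nlinarith [sq_nonneg (2 / π)]

/-- The canonical product over a sequence which is square-summably close to a translate of the
zeros of `cos`. -/
theorem exists_canonical_product (p : ℂ) (mu : ℤ → ℂ)
    (hmu : Summable fun n => ‖mu n - (cosZero n + p)‖ ^ 2) :
    ∃ P : ℂ → ℂ, Differentiable ℂ P ∧
      (∀ z, Tendsto (fun N : ℕ => ∏ n ∈ Finset.Icc (-(N : ℤ) - 1) (N : ℤ), (mu n - z) / cosZero n)
        atTop (nhds (P z))) ∧
      ∀ z, ZeroOrder P z (Nat.card {n : ℤ // mu n = z}) := by
  set t : ℤ → ℂ := fun n => mu n - (cosZero n + p) with ht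
  set q : ℕ → ℂ → ℂ := fun k z =>
    (mu k - z) / cosZero k * ((mu (-(k : ℤ) - 1) - z) / cosZero (-(k : ℤ) - 1)) with hq
  set g : ℕ → ℂ → ℂ := fun k z => q k z - 1 with hg
  have hqg : ∀ k z, 1 + g k z = q k z := fun k z => by simp [hg]
  have hgd : ∀ k, Differentiable ℂ (g k) := fun k => by
    simp only [hg, hq]
    fun_prop
  have hginj : Function.Injective fun k : ℕ => (k : ℤ) := Nat.cast_injective
  have hgneg : Function.Injective fun k : ℕ => -(k : ℤ) - 1 := fun a b h => by
    simp only at h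
    omega
  have hbound : ∀ R : ℝ, ∃ u : ℕ → ℝ, Summable u ∧ ∀ k z, ‖z‖ < R → ‖g k z‖ ≤ u k := by
    intro R
    refine ⟨fun k => 2 * (‖t k‖ ^ 2 + ‖t (-(k : ℤ) - 1)‖ ^ 2) +
      (1 + 2 * (‖p‖ + R) ^ 2) * (1 / ‖cosZero k‖ ^ 2), ?_, ?_⟩
    · exact (((hmu.comp_injective hginj).add (hmu.comp_injective hgneg)).mul_left 2).add
        ((summable_inv_norm_cosZero_sq.comp_injective hginj).mul_left _)
    · intro k z hz
      have h0 := cosZero_ne_zero k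
      have h1 := one_le_norm_cosZero k
      have e : g k z = (t k - t (-(k : ℤ) - 1)) * (1 / cosZero k) -
          (p - z + t k) * (1 / cosZero k) * ((p - z + t (-(k : ℤ) - 1)) * (1 / cosZero k)) := by
        simp only [hg, hq, ht, cosZero_neg_sub_one]
        field_simp
        ring
      set l := ‖1 / cosZero k‖ with hl
      have hll : 1 / ‖cosZero k‖ ^ 2 = l ^ 2 := by rw [hl]; simp
      have hl0 : 0 ≤ l := norm_nonneg _
      have hl1 : l ≤ 1 := by
        rw [hl, norm_div, norm_one]
        exact (div_le_one (by linarith)).2 h1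
      have hpz : ‖p - z‖ ≤ ‖p‖ + R := (norm_sub_le _ _).trans (by linarith)
      set M := ‖p‖ + R
      have hM : 0 ≤ M := (norm_nonneg _).trans hpz
      set x := ‖t k‖
      set y := ‖t (-(k : ℤ) - 1)‖
      have hx : 0 ≤ x := norm_nonneg _
      have hy : 0 ≤ y := norm_nonneg _
      have b1 : ‖g k z‖ ≤ (x + y) * l + (M + x) * l * ((M + y) * l) := by
        rw [e]
        refine (norm_sub_le _ _).trans ?_
        rw [norm_mul, norm_mul, norm_mul, norm_mul]
        gcongr
        · exact norm_sub_le _ _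
        · exact (norm_add_le _ _).trans (by gcongr)
        · exact (norm_add_le _ _).trans (by gcongr)
      have b2 : ∀ s : ℝ, 0 ≤ s → ((M + s) * l) ^ 2 ≤ 2 * s ^ 2 + 2 * M ^ 2 * l ^ 2 := by
        intro s hs
        have : s * l ≤ s := mul_le_of_le_one_right hs hl1
        nlinarith [sq_nonneg (M * l - s * l), mul_nonneg hs hl0]
      change ‖g k z‖ ≤ 2 * (x ^ 2 + y ^ 2) + (1 + 2 * M ^ 2) * (1 / ‖cosZero k‖ ^ 2)
      rw [hll]
      nlinarith [b2 x hx, b2 y hy, sq_nonneg (x - l), sq_nonneg (y - l),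
        sq_nonneg ((M + x) * l - (M + y) * l), sq_nonneg x, sq_nonneg y]
  have hsum : ∀ z, Summable fun k => ‖g k z‖ := by
    intro z
    obtain ⟨u, hu, hb⟩ := hbound (‖z‖ + 1)
    exact hu.of_nonneg_of_le (fun _ => norm_nonneg _) fun k => hb k z (by linarith)
  have hmult : ∀ z, Multipliable fun k => 1 + g k z := fun z =>
    multipliable_one_add_of_summable (hsum z)
  refine ⟨fun z => ∏' k, (1 + g k z), differentiable_tprod_one_add hgd hbound, fun z => ?_,
    fun z => ?_⟩
  · have := (hmult z).hasProd.tendsto_prod_nat.comp (tendsto_add_atTop_nat 1)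
    refine this.congr fun N => ?_
    rw [prod_Icc_eq_prod_range_pairs]
    exact Finset.prod_congr rfl fun k _ => hqg k z
  · have htend : Tendsto (fun k => 1 + g k z) atTop (nhds 1) := by
      simpa using (tendsto_zero_iff_norm_tendsto_zero.2 (hsum z).tendsto_atTop_zero).const_add 1
    obtain ⟨N, hN⟩ := eventually_atTop.1 (htend.eventually_ne one_ne_zero)
    have htail : ZeroOrder (fun w => ∏' k, (1 + g (k + (N + 1)) w)) z 0 := by
      apply ZeroOrder.of_ne_zero
      · apply Differentiable.analyticAt
        refine differentiable_tprod_one_add (fun k => hgd _) fun R => ?_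
        obtain ⟨u, hu, hb⟩ := hbound R
        exact ⟨fun k => u (k + (N + 1)), (summable_nat_add_iff (N + 1)).2 hu,
          fun k w hw => hb _ w hw⟩
      · exact tprod_one_add_ne_zero_of_summable (fun k => hN _ (by omega))
          ((summable_nat_add_iff (f := fun k => ‖g k z‖) (N + 1)).2 (hsum z))
    have hprod := (ZeroOrder.finset_prod_linear mu cosZero cosZero_ne_zero z
      (Finset.Icc (-(N : ℤ) - 1) (N : ℤ))).mul htail
    have hcard : ((Finset.Icc (-(N : ℤ) - 1) (N : ℤ)).filter fun i => mu i = z).card + 0 =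
        Nat.card {n : ℤ // mu n = z} := by
      rw [add_zero]
      refine (Nat.subtype_card _ fun n => ?_).symm
      simp only [Finset.mem_filter, Finset.mem_Icc, and_iff_right_iff_imp]
      intro hn
      by_contra hcon
      rcases le_or_gt 0 n with h | h
      · lift n to ℕ using h
        refine hN n (by omega) ?_
        simp [hqg, hq, hn]
      · obtain ⟨k, rfl⟩ : ∃ k : ℕ, n = -(k : ℤ) - 1 := ⟨(-n - 1).toNat, by omega⟩
        refine hN k (by omega) ?_
        simp [hqg, hq, hn]
    rw [← hcard]
    convert hprod using 1
    ext w
    rw [prod_Icc_eq_prod_range_pairs,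
      ← Multipliable.prod_mul_tprod_nat_mul' (k := N + 1) (f := fun k => 1 + g k w)]
    · congr 1
      exact Finset.prod_congr rfl fun k _ => hqg k w
    · exact multipliable_one_add_of_summable
        ((summable_nat_add_iff (f := fun k => ‖g k w‖) (N + 1)).2 (hsum w))

theorem tendsto_cos_prod (w : ℂ) :
    Tendsto (fun N : ℕ => ∏ n ∈ Finset.Icc (-(N : ℤ) - 1) (N : ℤ), (cosZero n - w) / cosZero n)
      atTop (nhds (Complex.cos w)) := by
  obtain ⟨P, hPd, hP, -⟩ := exists_canonical_product 0 cosZero (by simp)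
  suffices h : P = Complex.cos by simpa [h] using hP w
  have hsin : ∀ w, Complex.sin w ≠ 0 → P w = Complex.cos w := by
    intro w hw
    have hpi : (π : ℂ) ≠ 0 := Complex.ofReal_ne_zero.2 Real.pi_ne_zero
    have h1 := (Complex.tendsto_euler_sin_prod (w / π)).comp (tendsto_add_atTop_nat 1)
    have h2 := (Complex.tendsto_euler_sin_prod (2 * w / π)).comp
      ((tendsto_id.const_mul_atTop' two_pos).comp (tendsto_add_atTop_nat 1))
    have hsplit : ∀ M : ℕ, ∏ j ∈ Finset.range (2 * M),
        (1 - (2 * w / π) ^ 2 / ((j : ℂ) + 1) ^ 2) =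
        (∏ j ∈ Finset.range M, (1 - (w / π) ^ 2 / ((j : ℂ) + 1) ^ 2)) *
        ∏ k ∈ Finset.range M, ((cosZero k - w) / cosZero k *
          ((cosZero (-(k : ℤ) - 1) - w) / cosZero (-(k : ℤ) - 1))) := by
      intro M
      induction M with
      | zero => simp
      | succ M ih =>
        rw [Nat.mul_succ, Finset.prod_range_succ, Finset.prod_range_succ, ih,
          Finset.prod_range_succ, Finset.prod_range_succ]
        have a1 : ((2 * M : ℕ) : ℂ) + 1 ≠ 0 := Nat.cast_add_one_ne_zero _
        have a2 : (M : ℂ) + 1 ≠ 0 := Nat.cast_add_one_ne_zero _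
        have e1 : (1 - (2 * w / π) ^ 2 / (((2 * M : ℕ) : ℂ) + 1) ^ 2) =
            (cosZero M - w) / cosZero M *
              ((cosZero (-(M : ℤ) - 1) - w) / cosZero (-(M : ℤ) - 1)) := by
          have e : cosZero M = π * (((2 * M : ℕ) : ℂ) + 1) / 2 := by
            simp only [cosZero]
            push_cast
            ring
          rw [cosZero_neg_sub_one, e]
          field_simp
          ring
        have e2 : (1 - (2 * w / π) ^ 2 / (((2 * M + 1 : ℕ) : ℂ) + 1) ^ 2) =
            1 - (w / π) ^ 2 / ((M : ℂ) + 1) ^ 2 := by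
          have e : ((2 * M + 1 : ℕ) : ℂ) + 1 = 2 * ((M : ℂ) + 1) := by
            push_cast
            ring
          rw [e]
          field_simp
        rw [e1, e2]
        ring
    have h3 := (h1.const_mul 2).mul (hP w)
    have h4 := tendsto_nhds_unique (h2.congr fun N => ?_) h3
    · rw [mul_div_cancel₀ _ hpi, mul_div_cancel₀ _ hpi, Complex.sin_two_mul] at h4
      exact (mul_left_cancel₀ (mul_ne_zero two_ne_zero hw) h4).symm
    · simp only [Function.comp_apply, id]
      rw [hsplit, prod_Icc_eq_prod_range_pairs]
      ring
  have hPan : AnalyticOnNhd ℂ P Set.univ := fun z _ => hPd.analyticAt z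
  have hcan : AnalyticOnNhd ℂ Complex.cos Set.univ := fun z _ =>
    Complex.differentiable_cos.analyticAt z
  refine hPan.eq_of_eventuallyEq hcan (z₀ := (π / 2 : ℂ)) ?_
  have : ∀ᶠ z in nhds (π / 2 : ℂ), Complex.sin z ≠ 0 :=
    Complex.continuous_sin.continuousAt.eventually_ne (by simp)
  exact this.mono hsin

theorem eventually_sum_norm_div_cosZero_sub_le {t : ℤ → ℂ} (ht : Summable fun n => ‖t n‖ ^ 2)
    {ε : ℝ} (hε : 0 < ε) :
    ∀ᶠ w in Bornology.cobounded ℂ, (∀ n, 1 ≤ ‖cosZero n - w‖) → ∀ S : Finset ℤ,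
      ∑ n ∈ S, ‖t n / (cosZero n - w)‖ ≤ ε := by
  obtain ⟨B, hB0, hB⟩ := exists_sum_inv_norm_cosZero_sub_sq_le
  set δ := ε / (2 + B) with hδ
  have hδ0 : 0 < δ := by positivity
  obtain ⟨s, hs⟩ := summable_iff_vanishing_norm.1 ht (δ ^ 2) (by positivity)
  have hhead : Tendsto (fun w => ∑ n ∈ s, ‖t n / (cosZero n - w)‖) (Bornology.cobounded ℂ)
      (nhds 0) := by
    rw [← Finset.sum_const_zero (s := s)]
    refine tendsto_finsetSum _ fun n _ => ?_
    rw [← tendsto_zero_iff_norm_tendsto_zero]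
    have h1 : Tendsto (fun w : ℂ => cosZero n - w) (Bornology.cobounded ℂ)
        (Bornology.cobounded ℂ) := tendsto_const_sub_cobounded (cosZero n)
    simpa [div_eq_mul_inv] using (tendsto_inv₀_cobounded.comp h1).const_mul (t n)
  filter_upwards [hhead.eventually_lt_const hδ0] with w hw hA S
  have htail : ∑ n ∈ S \ s, ‖t n / (cosZero n - w)‖ ≤ (δ + δ * B) / 2 := by
    have h1 : ∑ n ∈ S \ s, ‖t n‖ ^ 2 ≤ δ ^ 2 :=
      (le_abs_self _).trans (hs _ Finset.sdiff_disjoint).le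
    calc ∑ n ∈ S \ s, ‖t n / (cosZero n - w)‖
        ≤ ∑ n ∈ S \ s, (1 / (2 * δ) * ‖t n‖ ^ 2 + δ / 2 * (1 / ‖cosZero n - w‖ ^ 2)) := by
          refine Finset.sum_le_sum fun n _ => ?_
          have e : 1 / ‖cosZero n - w‖ ^ 2 = (1 / ‖cosZero n - w‖) ^ 2 := by simp
          rw [norm_div, e, div_eq_mul_one_div]
          set y := 1 / ‖cosZero n - w‖
          have e2 : 1 / (2 * δ) * ‖t n‖ ^ 2 + δ / 2 * y ^ 2 - ‖t n‖ * y =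
              1 / (2 * δ) * (‖t n‖ - δ * y) ^ 2 := by
            field_simp
            ring
          have : 0 ≤ 1 / (2 * δ) * (‖t n‖ - δ * y) ^ 2 := by positivity
          linarith
      _ = 1 / (2 * δ) * ∑ n ∈ S \ s, ‖t n‖ ^ 2 +
          δ / 2 * ∑ n ∈ S \ s, 1 / ‖cosZero n - w‖ ^ 2 := by
          rw [Finset.sum_add_distrib, Finset.mul_sum, Finset.mul_sum]
      _ ≤ 1 / (2 * δ) * δ ^ 2 + δ / 2 * B := by
          gcongr
          exact hB w hA _
      _ = _ := by field_simp
  calc ∑ n ∈ S, ‖t n / (cosZero n - w)‖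
      ≤ ∑ n ∈ s ∪ S \ s, ‖t n / (cosZero n - w)‖ :=
        Finset.sum_le_sum_of_subset_of_nonneg (by simp) fun _ _ _ => norm_nonneg _
    _ = ∑ n ∈ s, ‖t n / (cosZero n - w)‖ + ∑ n ∈ S \ s, ‖t n / (cosZero n - w)‖ :=
        Finset.sum_union Finset.disjoint_sdiff
    _ ≤ δ + (δ + δ * B) / 2 := add_le_add hw.le htail
    _ ≤ δ * (2 + B) := by nlinarith [mul_nonneg hδ0.le hB0]
    _ = ε := by rw [hδ]; field_simp

/-- Away from the zeros of `cos`, the canonical product is asymptotic to `cos (z - p)`. -/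
theorem tendsto_canonical_product_div_cos {p : ℂ} {mu : ℤ → ℂ}
    (hmu : Summable fun n => ‖mu n - (cosZero n + p)‖ ^ 2) {P : ℂ → ℂ}
    (hP : ∀ z, Tendsto (fun N : ℕ => ∏ n ∈ Finset.Icc (-(N : ℤ) - 1) (N : ℤ),
      (mu n - z) / cosZero n) atTop (nhds (P z))) :
    Tendsto (fun z => P z / Complex.cos (z - p))
      (Bornology.cobounded ℂ ⊓ 𝓟 {z | ∀ n, 1 ≤ ‖cosZero n - (z - p)‖}) (nhds 1) := by
  rw [Metric.tendsto_nhds]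
  intro ε hε
  rw [eventually_inf_principal]
  have hη : 0 < Real.log (1 + ε / 2) := Real.log_pos (by linarith)
  have hshift : Tendsto (fun z : ℂ => z - p) (Bornology.cobounded ℂ) (Bornology.cobounded ℂ) :=
    tendsto_sub_const_cobounded p
  filter_upwards [hshift.eventually (eventually_sum_norm_div_cosZero_sub_le hmu hη)] with z hz hA
  have hcos : Complex.cos (z - p) ≠ 0 := norm_pos_iff.1
    (lt_of_lt_of_le (by positivity) (two_div_pi_le_norm_cos hA))
  have hlim : Tendsto (fun N : ℕ => ∏ n ∈ Finset.Icc (-(N : ℤ) - 1) (N : ℤ),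
      (1 + (mu n - (cosZero n + p)) / (cosZero n - (z - p)))) atTop
      (nhds (P z / Complex.cos (z - p))) := by
    refine ((hP z).div (tendsto_cos_prod (z - p)) hcos).congr fun N => ?_
    rw [Pi.div_apply, ← Finset.prod_div_distrib]
    refine Finset.prod_congr rfl fun n _ => ?_
    have h1 : cosZero n - (z - p) ≠ 0 := norm_pos_iff.1 (one_pos.trans_le (hA n))
    have h2 := cosZero_ne_zero n
    field_simp
    ring
  have hle : dist (P z / Complex.cos (z - p)) 1 ≤ ε / 2 := by
    refine le_of_tendsto (hlim.dist tendsto_const_nhds) (Eventually.of_forall fun N => ?_)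
    rw [dist_eq_norm]
    refine (Finset.norm_prod_one_add_sub_one_le _ _).trans ?_
    have := Real.exp_le_exp.2 (hz hA (Finset.Icc (-(N : ℤ) - 1) (N : ℤ)))
    rw [Real.exp_log (by linarith)] at this
    linarith
  linarith

/-- **Phragmén–Lindelöf** in the four sectors bounded by the diagonals: an entire function of
exponential type that is bounded on the diagonals is constant. -/
theorem eq_of_bounded_on_diagonals {F : ℂ → ℂ} (hF : Differentiable ℂ F) {D σ C : ℝ}
    (hgrowth : ∀ z, ‖F z‖ ≤ D * Real.exp (σ * ‖z‖))
    (hdiag : ∀ j : ℕ, j < 4 → ∀ r : ℝ, 0 ≤ r →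
      ‖F (r * Complex.exp (((π / 4 + j * (π / 2) : ℝ) : ℂ) * I))‖ ≤ C) (z w : ℂ) : F z = F w := by
  set u : ℂ := Complex.exp (((π / 4 : ℝ) : ℂ) * I) with hu
  have hu1 : ‖u‖ = 1 := Complex.norm_exp_ofReal_mul_I _
  have hu0 : u ≠ 0 := Complex.exp_ne_zero _
  set h : ℂ → ℂ := fun z => F (z * u) with hh
  have hhd : Differentiable ℂ h := hF.comp (differentiable_id.mul_const u)
  have hO : ∀ l : Filter ℂ, ∃ c < (2 : ℝ), ∃ B,
      h =O[l] fun z => Real.exp (B * ‖z‖ ^ c) := by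
    refine fun l => ⟨1, by norm_num, σ, Asymptotics.IsBigO.of_bound D (Eventually.of_forall ?_)⟩
    intro z
    simpa [hh, hu1, abs_of_pos (Real.exp_pos _)] using hgrowth (z * u)
  have hI : Complex.exp ((π / 2 : ℂ) * I) = I := Complex.exp_pi_div_two_mul_I
  have hdir : ∀ j : ℕ, Complex.exp (((π / 4 + j * (π / 2) : ℝ) : ℂ) * I) = u * I ^ j := by
    intro j
    rw [hu, show I ^ j = Complex.exp (j * ((π / 2 : ℂ) * I)) by rw [Complex.exp_nat_mul, hI],
      ← Complex.exp_add]
    congr 1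
    push_cast
    ring
  have hax : ∀ j : ℕ, j < 4 → ∀ r : ℝ, 0 ≤ r → ‖h (r * I ^ j)‖ ≤ C := by
    intro j hj r hr
    have := hdiag j hj r hr
    rw [hdir] at this
    simpa only [hh, mul_assoc, mul_comm u] using this
  have h0 : ∀ x : ℝ, 0 ≤ x → ‖h x‖ ≤ C := fun x hx => by simpa using hax 0 (by norm_num) x hx
  have h1 : ∀ x : ℝ, 0 ≤ x → ‖h (x * I)‖ ≤ C := fun x hx => by simpa using hax 1 (by norm_num) x hx
  have h2 : ∀ x : ℝ, x ≤ 0 → ‖h x‖ ≤ C := fun x hx => by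
    simpa using hax 2 (by norm_num) (-x) (by linarith)
  have h3 : ∀ x : ℝ, x ≤ 0 → ‖h (x * I)‖ ≤ C := fun x hx => by
    simpa [pow_succ] using hax 3 (by norm_num) (-x) (by linarith)
  have hbd : ∀ z, ‖h z‖ ≤ C := by
    intro z
    rcases le_total 0 z.re with hr | hr <;> rcases le_total 0 z.im with hi | hi
    · exact PhragmenLindelof.quadrant_I hhd.diffContOnCl (hO _) h0 h1 hr hi
    · exact PhragmenLindelof.quadrant_IV hhd.diffContOnCl (hO _) h0 h3 hr hi
    · exact PhragmenLindelof.quadrant_II hhd.diffContOnCl (hO _) h2 h1 hr hi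
    · exact PhragmenLindelof.quadrant_III hhd.diffContOnCl (hO _) h2 h3 hr hi
  have hb : Bornology.IsBounded (Set.range h) :=
    isBounded_iff_forall_norm_le.2 ⟨C, by rintro _ ⟨z, rfl⟩; exact hbd z⟩
  simpa [hh, hu0] using hhd.apply_eq_apply_of_bounded hb (z / u) (w / u)

theorem exists_exponential_bound_of_circles {F : ℂ → ℂ} (hF : Differentiable ℂ F) {p : ℂ}
    {D σ : ℝ} (hD : 0 ≤ D) (hσ : 0 ≤ σ) {K : ℕ}
    (hcirc : ∀ k : ℕ, K ≤ k → ∀ z, ‖z - p‖ = π * k → ‖F z‖ ≤ D * Real.exp (σ * ‖z‖)) :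
    ∃ D', ∀ z, ‖F z‖ ≤ D' * Real.exp (σ * ‖z‖) := by
  refine ⟨D * Real.exp (σ * (2 * ‖p‖ + π * (K + 2))), fun z => ?_⟩
  set k : ℕ := K + ⌈‖z - p‖ / π⌉₊ + 1 with hk
  have h1 : ‖z - p‖ < π * k := by
    rw [← div_lt_iff₀' Real.pi_pos]
    have := Nat.le_ceil (‖z - p‖ / π)
    rw [hk]
    push_cast
    have : (0 : ℝ) ≤ K := Nat.cast_nonneg _
    linarith
  have h2 : π * k ≤ ‖z - p‖ + π * (K + 2) := by
    have := (Nat.ceil_lt_add_one (a := ‖z - p‖ / π) (by positivity)).le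
    have h3 : (k : ℝ) ≤ ‖z - p‖ / π + (K + 2) := by
      rw [hk]
      push_cast
      linarith
    calc π * k ≤ π * (‖z - p‖ / π + (K + 2)) := by gcongr
      _ = _ := by field_simp
  have hkpos : π * (k : ℝ) ≠ 0 := ((norm_nonneg _).trans_lt h1).ne'
  have hmem : z ∈ closure (Metric.ball p (π * k)) :=
    subset_closure (by rwa [Metric.mem_ball, dist_eq_norm])
  refine (Complex.norm_le_of_forall_mem_frontier_norm_le Metric.isBounded_ball hF.diffContOnCl
    (C := D * Real.exp (σ * (2 * ‖p‖ + π * (K + 2)) + σ * ‖z‖)) ?_ hmem).trans_eq ?_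
  · intro ζ hζ
    rw [frontier_ball p hkpos, mem_sphere_iff_norm] at hζ
    refine (hcirc k (by omega) ζ hζ).trans ?_
    rw [← mul_add]
    gcongr
    have h3 : ‖ζ‖ ≤ ‖ζ - p‖ + ‖p‖ := by simpa using norm_add_le (ζ - p) p
    have h4 : ‖z - p‖ ≤ ‖z‖ + ‖p‖ := norm_sub_le _ _
    linarith
  · rw [Real.exp_add, mul_assoc]

theorem one_le_norm_cosZero_sub_of_norm_eq {w : ℂ} {k : ℕ} (hw : ‖w‖ = π * k) (n : ℤ) :
    1 ≤ ‖cosZero n - w‖ := by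
  refine le_trans ?_ (abs_norm_sub_norm_le (cosZero n) w)
  rw [hw, cosZero_eq_ofReal, Complex.norm_real, Real.norm_eq_abs, abs_mul, abs_of_pos Real.pi_pos]
  rcases le_or_gt 0 n with hn | hn
  · have : (0 : ℝ) ≤ n := by exact_mod_cast hn
    rw [abs_of_nonneg (by linarith : 0 ≤ (n : ℝ) + 1 / 2)]
    have h := one_le_abs_pi_mul_int_add_half (n - k)
    push_cast at h
    rwa [show π * ((n : ℝ) + 1 / 2) - π * k = π * ((n : ℝ) - k + 1 / 2) by ring]
  · have : (n : ℝ) ≤ -1 := by exact_mod_cast (by omega : n ≤ -1)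
    rw [abs_of_neg (by linarith : (n : ℝ) + 1 / 2 < 0)]
    have h := one_le_abs_pi_mul_int_add_half (-n - 1 - k)
    push_cast at h
    rwa [show π * -((n : ℝ) + 1 / 2) - π * k = π * (-(n : ℝ) - 1 - k + 1 / 2) by ring]

theorem tendsto_ray_cobounded_inf_away {θ : ℝ} (hθ : Real.sin θ ≠ 0) (p : ℂ) :
    Tendsto (fun r : ℝ => (r : ℂ) * Complex.exp (θ * I)) atTop
      (Bornology.cobounded ℂ ⊓ 𝓟 {z | ∀ n, 1 ≤ ‖cosZero n - (z - p)‖}) := by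
  refine tendsto_inf.2 ⟨?_, tendsto_principal.2 ?_⟩
  · rw [← tendsto_norm_atTop_iff_cobounded]
    simpa [Complex.norm_exp_ofReal_mul_I] using tendsto_abs_atTop_atTop
  · have hs : 0 < |Real.sin θ| := abs_pos.2 hθ
    filter_upwards [eventually_ge_atTop ((1 + |p.im|) / |Real.sin θ|), eventually_ge_atTop 0]
      with r hr hr0 n
    rw [div_le_iff₀ hs] at hr
    have h1 := Complex.abs_im_le_norm (cosZero n - ((r : ℂ) * Complex.exp (θ * I) - p))
    have h2 : (cosZero n - ((r : ℂ) * Complex.exp (θ * I) - p)).im = p.im - r * Real.sin θ := by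
      rw [cosZero_eq_ofReal, Complex.sub_im, Complex.sub_im, Complex.im_ofReal_mul,
        Complex.exp_ofReal_mul_I_im, Complex.ofReal_im]
      ring
    rw [h2] at h1
    have h3 : |r * Real.sin θ| - |p.im| ≤ |p.im - r * Real.sin θ| := by
      rw [abs_sub_comm]
      exact abs_sub_abs_le_abs_sub _ _
    rw [abs_mul, abs_of_nonneg hr0] at h3
    linarith

theorem exists_norm_le_of_tendsto_atTop {E : Type*} [NormedAddCommGroup E] {f : ℝ → E}
    (hf : Continuous f) {a : E} (h : Tendsto f atTop (nhds a)) :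
    ∃ C, ∀ r, 0 ≤ r → ‖f r‖ ≤ C := by
  obtain ⟨R, hR⟩ := eventually_atTop.1 (h.norm.eventually_le_const (lt_add_one ‖a‖))
  obtain ⟨C, hC⟩ := (isCompact_Icc (a := (0 : ℝ)) (b := R)).exists_bound_of_continuousOn
    hf.continuousOn
  refine ⟨max C (‖a‖ + 1), fun r hr => ?_⟩
  rcases le_total r R with h | h
  · exact le_max_of_le_left (hC r ⟨hr, h⟩)
  · exact le_max_of_le_right (hR r h)

theorem sin_ne_zero_of_mem_Ioo {θ : ℝ} (hθ : θ ∈ Set.Ioo 0 (2 * π)) (hπ : θ ≠ π) :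
    Real.sin θ ≠ 0 := by
  rcases lt_or_gt_of_ne hπ with h | h
  · exact (Real.sin_pos_of_pos_of_lt_pi hθ.1 h).ne'
  · rw [← Real.sin_sub_two_pi]
    exact (Real.sin_neg_of_neg_of_neg_pi_lt (by linarith [hθ.2]) (by linarith)).ne

/-- Factorization of the characteristic function of the mixed problem: if `ψ` is entire of
finite exponential type, `ψ(0) ≠ 0`, `ψ(re^{iθ})/cos(re^{iθ} − p₀) → 1` along every
non-real ray, and the zeros of `ψ` (with multiplicity) are `(μₙ)_{n∈ℤ}` with
`μₙ = π(n+1/2) + p₀ + μ̃ₙ`, `(μ̃ₙ) ∈ ℓ²`, where `p₀ ∉ π/2 + πℤ`, then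
`ψ(μ) = lim_{N→∞} ∏_{n=−N−1}^{N} (μₙ − μ)/(π(n+1/2))` for every `μ`. -/
theorem mixed_characteristic_factorization
    (p₀ : ℂ) (hp₀ : ¬ ∃ l : ℤ, p₀ = (π : ℂ) / 2 + (π : ℂ) * l)
    (ψ : ℂ → ℂ) (hψ : Differentiable ℂ ψ)
    (htype : ∃ C σ : ℝ, 0 ≤ C ∧ 0 ≤ σ ∧ ∀ z : ℂ, ‖ψ z‖ ≤ C * Real.exp (σ * ‖z‖))
    (h0 : ψ 0 ≠ 0)
    (hray : ∀ θ : ℝ, θ ∈ Set.Ioo 0 (2 * π) → θ ≠ π →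
      Tendsto (fun r : ℝ =>
          ψ (r * Complex.exp (θ * I)) / Complex.cos (r * Complex.exp (θ * I) - p₀))
        atTop (nhds 1))
    (mu : ℤ → ℂ)
    (henum : ∀ z : ℂ, ZeroOrder ψ z (Nat.card {n : ℤ // mu n = z}))
    (hasymp : Summable (fun n : ℤ =>
        ‖mu n - ((π : ℂ) * ((n : ℤ) + 1/2) + p₀)‖ ^ 2)) :
    ∀ μ : ℂ,
      Tendsto (fun N : ℕ =>
          ∏ n ∈ Finset.Icc (-(N:ℤ) - 1) (N:ℤ), (mu n - μ) / ((π : ℂ) * ((n : ℤ) + 1/2)))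
        atTop (nhds (ψ μ)) := by
  obtain ⟨C, σ, hC, hσ, hexp⟩ := htype
  obtain ⟨P, hPd, hP, hPz⟩ := exists_canonical_product p₀ mu hasymp
  obtain ⟨F, hFd, hF⟩ := exists_differentiable_quotient henum hPz
  have hlim := tendsto_canonical_product_div_cos hasymp hP
  have hFray : ∀ θ : ℝ, θ ∈ Set.Ioo 0 (2 * π) → θ ≠ π →
      Tendsto (fun r : ℝ => F (r * Complex.exp (θ * I))) atTop (nhds 1) := by
    intro θ hθ hθπ
    have hPray := hlim.comp (tendsto_ray_cobounded_inf_away (sin_ne_zero_of_mem_Ioo hθ hθπ) p₀)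
    have hdiv := (hray θ hθ hθπ).div hPray one_ne_zero
    rw [div_one] at hdiv
    refine hdiv.congr' ?_
    filter_upwards [hPray.eventually_ne one_ne_zero] with r hr
    simp only [Function.comp_apply, Pi.div_apply] at hr ⊢
    obtain ⟨h1, h2⟩ := div_ne_zero_iff.1 hr
    rw [hF, div_div_div_cancel_right₀ h2, mul_div_cancel_right₀ _ h1]
  obtain ⟨D, hgrowth⟩ : ∃ D, ∀ z, ‖F z‖ ≤ D * Real.exp (σ * ‖z‖) := by
    have hhalf := hlim.norm.eventually_const_le (u := 1 / 2) (by norm_num)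
    rw [eventually_inf_principal, hasBasis_cobounded_norm.eventually_iff] at hhalf
    obtain ⟨R, -, hR⟩ := hhalf
    obtain ⟨K, hK⟩ := exists_nat_ge (R + ‖p₀‖)
    refine exists_exponential_bound_of_circles hFd (p := p₀) (D := π * C) (K := K) (by positivity)
      hσ fun k hk z hz => ?_
    have hA := one_le_norm_cosZero_sub_of_norm_eq hz
    have hzR : R ≤ ‖z‖ := by
      have h1 : ‖z - p₀‖ ≤ ‖z‖ + ‖p₀‖ := norm_sub_le _ _
      have h2 : (K : ℝ) ≤ k := by exact_mod_cast hk
      have h3 : (0 : ℝ) ≤ k := Nat.cast_nonneg _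
      nlinarith [Real.pi_gt_three]
    have h1 : 1 / 2 ≤ ‖P z / Complex.cos (z - p₀)‖ := hR hzR hA
    have h2 := two_div_pi_le_norm_cos hA
    have h3 : 1 / π ≤ ‖P z‖ := by
      rw [norm_div, le_div_iff₀ (lt_of_lt_of_le (by positivity) h2)] at h1
      refine le_trans ?_ h1
      calc 1 / π = 1 / 2 * (2 / π) := by field_simp
        _ ≤ _ := by gcongr
    have h4 : ‖F z‖ * (1 / π) ≤ C * Real.exp (σ * ‖z‖) := by
      refine le_trans ?_ (hexp z)
      rw [hF, norm_mul]
      gcongr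
    rw [mul_one_div, div_le_iff₀ Real.pi_pos] at h4
    linarith
  have hθ : ∀ j : ℕ, j < 4 →
      π / 4 + j * (π / 2) ∈ Set.Ioo 0 (2 * π) ∧ π / 4 + j * (π / 2) ≠ π := by
    intro j hj
    have hπ := Real.pi_pos
    refine ⟨⟨by positivity, ?_⟩, ?_⟩
    · have : (j : ℝ) ≤ 3 := by exact_mod_cast (by omega : j ≤ 3)
      nlinarith
    · interval_cases j <;> norm_num <;> intro h <;> linarith
  have hbd : ∀ j : ℕ, j < 4 → ∃ C, ∀ r : ℝ, 0 ≤ r →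
      ‖F (r * Complex.exp (((π / 4 + j * (π / 2) : ℝ) : ℂ) * I))‖ ≤ C := fun j hj =>
    exists_norm_le_of_tendsto_atTop
      (f := fun r : ℝ => F (r * Complex.exp (((π / 4 + j * (π / 2) : ℝ) : ℂ) * I)))
      (hFd.continuous.comp (by fun_prop)) (hFray _ (hθ j hj).1 (hθ j hj).2)
  choose! B hB using hbd
  have hconst := eq_of_bounded_on_diagonals hFd (C := ∑ j ∈ Finset.range 4, B j) hgrowth
    fun j hj r hr => (hB j hj r hr).trans
      (Finset.single_le_sum
        (fun i hi => (norm_nonneg _).trans (hB i (Finset.mem_range.1 hi) 0 le_rfl))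
        (Finset.mem_range.2 hj))
  have hone : ∀ z, F z = 1 := fun z =>
    tendsto_nhds_unique (tendsto_const_nhds.congr fun r => hconst z _)
      (hFray _ (hθ 0 (by norm_num)).1 (hθ 0 (by norm_num)).2)
  intro μ
  rw [hF, hone, one_mul]
  exact hP μ
end

section
/- Let p₀ ∈ ℂ and let (λ̃ₙ)_{n∈ℤ∖{0}} be a sequence of complex numbers with Σ_{n≠0}|λ̃ₙ|² < ∞. Set λₙ = πn + p₀ + λ̃ₙ and assume λₙ ≠ 0 for all n. Then the principal value series Σ_{n∈ℤ∖{0}} 1/λₙ converges, i.e., the limit as N → ∞ of the symmetric partial sums Σ_{0<|n|≤N} 1/λₙ exists in ℂ. -/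
open Real Filter

/-- A bounded perturbation of `πn` changes the reciprocals by a summable amount. -/
theorem summable_inv_sub_inv_of_bounded (lam : ℤ → ℂ) (M : ℝ)
    (hM : ∀ n : ℤ, n ≠ 0 → ‖lam n - π * n‖ ≤ M) :
    Summable (fun n : ℤ => if n = 0 then 0 else (lam n)⁻¹ - ((π : ℂ) * n)⁻¹) := by
  have hs : Summable (fun n : ℤ => M * (1 / (n : ℝ) ^ 2)) :=
    (Real.summable_one_div_int_pow.mpr one_lt_two).mul_left M
  refine Summable.of_norm_bounded_eventually hs ?_
  refine (Set.finite_Icc (-⌈M⌉) ⌈M⌉).subset fun n hn => ?_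
  by_contra hout
  apply hn
  have hM0 : 0 ≤ M := (norm_nonneg _).trans (hM 1 one_ne_zero)
  have habs : M ≤ |(n : ℝ)| := by
    have h : ⌈M⌉ < |n| := by
      rw [Set.mem_Icc, ← abs_le] at hout
      exact not_le.mp hout
    have h' : (⌈M⌉ : ℝ) < |(n : ℝ)| := by exact_mod_cast h
    exact (Int.le_ceil M).trans h'.le
  by_cases h0 : n = 0
  · simp [h0]
  have hn1 : 0 < |(n : ℝ)| := abs_pos.mpr (by exact_mod_cast h0)
  have hpin : ‖(π : ℂ) * n‖ = π * |(n : ℝ)| := by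
    rw [norm_mul, Complex.norm_real, Complex.norm_intCast, Real.norm_of_nonneg pi_pos.le]
  have hlow : |(n : ℝ)| ≤ ‖lam n‖ := by
    have h1 := norm_sub_norm_le ((π : ℂ) * n) (lam n)
    rw [norm_sub_rev, hpin] at h1
    nlinarith [hM n h0, pi_gt_three]
  have hlow' : |(n : ℝ)| ≤ ‖(π : ℂ) * n‖ := by
    rw [hpin]; nlinarith [pi_gt_three]
  have hl : lam n ≠ 0 := norm_pos_iff.mp (hn1.trans_le hlow)
  have hp : (π : ℂ) * n ≠ 0 := norm_pos_iff.mp (hn1.trans_le hlow')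
  rw [Set.mem_ofPred_eq, if_neg h0, inv_sub_inv hl hp, norm_div, norm_mul, norm_sub_rev,
    mul_one_div, ← sq_abs (n : ℝ), sq]
  have := hM n h0
  gcongr

theorem sum_Icc_neg_inv_mul_eq_zero (c : ℂ) (N : ℕ) :
    ∑ n ∈ (Finset.Icc (-(N : ℤ)) N).erase 0, (c * n)⁻¹ = 0 := by
  refine Finset.sum_involution (fun n _ => -n) ?_ ?_ ?_ ?_
  · intro n _
    simp [mul_neg, inv_neg]
  · intro n hn _ h
    have := (Finset.mem_erase.mp hn).1
    omega
  · intro n hn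
    simp only [Finset.mem_erase, Finset.mem_Icc] at hn ⊢
    omega
  · intro n _
    exact neg_neg n

/-- If `λₙ = πn + p₀ + λ̃ₙ` with `(λ̃ₙ)_{n∈ℤ∖{0}} ∈ ℓ²` and all `λₙ ≠ 0`, then the
principal-value series `Σ_{n∈ℤ∖{0}} 1/λₙ` converges, i.e. the symmetric partial sums over
`0 < |n| ≤ N` have a limit in `ℂ` as `N → ∞`. -/
theorem pv_sum_of_reciprocals_convergent
    (p₀ : ℂ) (tl : ℤ → ℂ)
    (htl : Summable (fun n : {n : ℤ // n ≠ 0} => ‖tl n‖ ^ 2))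
    (lam : ℤ → ℂ)
    (hlam : ∀ n : ℤ, n ≠ 0 → lam n = (π : ℂ) * n + p₀ + tl n)
    (hne : ∀ n : ℤ, n ≠ 0 → lam n ≠ 0) :
    ∃ L : ℂ,
      Tendsto (fun N : ℕ => ∑ n ∈ (Finset.Icc (-(N:ℤ)) (N:ℤ)).erase 0, (lam n)⁻¹)
        atTop (nhds L) := by
  set S := ∑' n : {n : ℤ // n ≠ 0}, ‖tl n‖ ^ 2
  have hbound : ∀ n : ℤ, n ≠ 0 → ‖lam n - π * n‖ ≤ ‖p₀‖ + √S := by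
    intro n hn
    have h1 : ‖tl n‖ ≤ √S :=
      Real.le_sqrt_of_sq_le (htl.le_tsum ⟨n, hn⟩ fun _ _ => sq_nonneg _)
    rw [hlam n hn, show (π : ℂ) * n + p₀ + tl n - π * n = p₀ + tl n by ring]
    exact (norm_add_le _ _).trans (by gcongr)
  have hsum := summable_inv_sub_inv_of_bounded lam _ hbound
  have hIcc : Tendsto (fun N : ℕ => Finset.Icc (-(N : ℤ)) N) atTop atTop := by
    refine tendsto_atTop_finset_of_monotone ?_ fun n => ⟨n.natAbs, ?_⟩
    · intro a b hab
      apply Finset.Icc_subset_Icc <;> omega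
    · rw [Finset.mem_Icc]
      omega
  refine ⟨_, (hsum.hasSum.comp hIcc).congr fun N => ?_⟩
  rw [Function.comp_apply, ← Finset.sum_erase (a := (0 : ℤ)) _ (by exact if_pos rfl),
    ← sub_zero (∑ n ∈ _, (lam n)⁻¹), ← sum_Icc_neg_inv_mul_eq_zero π N,
    ← Finset.sum_sub_distrib]
  exact Finset.sum_congr rfl fun n hn => if_neg (Finset.ne_of_mem_erase hn)
end

section
/- Let p₀ ∈ ℂ and let (λₙ)_{n∈ℤ} be complex numbers with λₙ = πn + p₀ + λ̃ₙ where Σ_{n∈ℤ}|λ̃ₙ|² < ∞. Then Σ_{n∈ℤ} ∫₀¹ ( |cos(λₙ x) − cos((πn + p₀)x)|² + |sin(λₙ x) − sin((πn + p₀)x)|² ) dx < ∞. (That is, in L²((0,1);ℂ²) the sequence u_{n,0}(x) = (cos λₙx, sin λₙx)ᵗ is quadratically close to the sequence vₙ(x) = (cos((πn+p₀)x), sin((πn+p₀)x))ᵗ.) -/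
open MeasureTheory Real

theorem norm_exp_sub_exp_le (z w : ℂ) :
    ‖Complex.exp z - Complex.exp w‖ ≤ Real.exp |w.re| * (‖z - w‖ * Real.exp ‖z - w‖) := by
  have h : Complex.exp z - Complex.exp w = Complex.exp w * (Complex.exp (z - w) - 1) := by
    rw [mul_sub, ← Complex.exp_add]
    simp
  rw [h, norm_mul, Complex.norm_exp]
  gcongr
  · exact le_abs_self _
  · simpa using Complex.norm_exp_sub_sum_le_norm_mul_exp (z - w) 1

theorem norm_exp_mul_I_sub_le (z w : ℂ) :
    ‖Complex.exp (z * Complex.I) - Complex.exp (w * Complex.I)‖ ≤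
      Real.exp |w.im| * (‖z - w‖ * Real.exp ‖z - w‖) := by
  simpa [← sub_mul] using norm_exp_sub_exp_le (z * Complex.I) (w * Complex.I)

theorem norm_exp_neg_mul_I_sub_le (z w : ℂ) :
    ‖Complex.exp (-z * Complex.I) - Complex.exp (-w * Complex.I)‖ ≤
      Real.exp |w.im| * (‖z - w‖ * Real.exp ‖z - w‖) := by
  have h := norm_exp_mul_I_sub_le (-z) (-w)
  rwa [← neg_sub', norm_neg, Complex.neg_im, abs_neg] at h

theorem norm_cos_sub_cos_le (z w : ℂ) :
    ‖Complex.cos z - Complex.cos w‖ ≤ Real.exp |w.im| * (‖z - w‖ * Real.exp ‖z - w‖) := by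
  have h : Complex.cos z - Complex.cos w =
      ((Complex.exp (z * Complex.I) - Complex.exp (w * Complex.I)) +
        (Complex.exp (-z * Complex.I) - Complex.exp (-w * Complex.I))) / 2 := by
    simp only [Complex.cos]
    ring
  rw [h, norm_div, Complex.norm_two, div_le_iff₀ two_pos]
  linarith [norm_add_le (Complex.exp (z * Complex.I) - Complex.exp (w * Complex.I))
    (Complex.exp (-z * Complex.I) - Complex.exp (-w * Complex.I)),
    norm_exp_mul_I_sub_le z w, norm_exp_neg_mul_I_sub_le z w]

theorem norm_sin_sub_sin_le (z w : ℂ) :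
    ‖Complex.sin z - Complex.sin w‖ ≤ Real.exp |w.im| * (‖z - w‖ * Real.exp ‖z - w‖) := by
  have h : Complex.sin z - Complex.sin w =
      ((Complex.exp (-z * Complex.I) - Complex.exp (-w * Complex.I)) -
        (Complex.exp (z * Complex.I) - Complex.exp (w * Complex.I))) * Complex.I / 2 := by
    simp only [Complex.sin]
    ring
  rw [h, norm_div, norm_mul, Complex.norm_I, mul_one, Complex.norm_two, div_le_iff₀ two_pos]
  linarith [norm_sub_le (Complex.exp (-z * Complex.I) - Complex.exp (-w * Complex.I))
    (Complex.exp (z * Complex.I) - Complex.exp (w * Complex.I)),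
    norm_exp_mul_I_sub_le z w, norm_exp_neg_mul_I_sub_le z w]

theorem integral_cos_sin_sub_sq_le (a b : ℂ) :
    ∫ x in (0:ℝ)..1, (‖Complex.cos (a * x) - Complex.cos (b * x)‖ ^ 2 +
        ‖Complex.sin (a * x) - Complex.sin (b * x)‖ ^ 2) ≤
      2 * (Real.exp |b.im| * (‖a - b‖ * Real.exp ‖a - b‖)) ^ 2 := by
  have hbound : ∀ x ∈ Set.Icc (0:ℝ) 1,
      ‖Complex.cos (a * x) - Complex.cos (b * x)‖ ^ 2 +
        ‖Complex.sin (a * x) - Complex.sin (b * x)‖ ^ 2 ≤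
      2 * (Real.exp |b.im| * (‖a - b‖ * Real.exp ‖a - b‖)) ^ 2 := by
    intro x hx
    have hx' : |x| ≤ 1 := abs_le.2 ⟨by linarith [hx.1], hx.2⟩
    have him : |(b * x).im| ≤ |b.im| := by
      rw [Complex.im_mul_ofReal, abs_mul]
      exact mul_le_of_le_one_right (abs_nonneg _) hx'
    have hd : ‖a * x - b * x‖ ≤ ‖a - b‖ := by
      rw [← sub_mul, norm_mul, Complex.norm_real]
      exact mul_le_of_le_one_right (norm_nonneg _) hx'
    have hle : Real.exp |(b * x).im| * (‖a * x - b * x‖ * Real.exp ‖a * x - b * x‖) ≤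
        Real.exp |b.im| * (‖a - b‖ * Real.exp ‖a - b‖) := by
      gcongr
    have hc := pow_le_pow_left₀ (norm_nonneg _) ((norm_cos_sub_cos_le (a * x) (b * x)).trans hle) 2
    have hs := pow_le_pow_left₀ (norm_nonneg _) ((norm_sin_sub_sin_le (a * x) (b * x)).trans hle) 2
    linarith
  have hcont : Continuous fun x : ℝ => ‖Complex.cos (a * x) - Complex.cos (b * x)‖ ^ 2 +
      ‖Complex.sin (a * x) - Complex.sin (b * x)‖ ^ 2 := by
    fun_prop
  simpa using intervalIntegral.integral_mono_on zero_le_one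
    (hcont.intervalIntegrable (μ := volume) 0 1)
    (intervalIntegrable_const (c := 2 * (Real.exp |b.im| * (‖a - b‖ * Real.exp ‖a - b‖)) ^ 2))
    hbound

/-- Quadratic closeness: if `λₙ = πn + p₀ + λ̃ₙ` with `(λ̃ₙ)_{n∈ℤ} ∈ ℓ²`, then in
`L²((0,1);ℂ²)` the vectors `u_{n,0}(x) = (cos λₙx, sin λₙx)ᵗ` are quadratically close to
`vₙ(x) = (cos((πn+p₀)x), sin((πn+p₀)x))ᵗ`. -/
theorem quadratically_close
    (p₀ : ℂ) (lam : ℤ → ℂ)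
    (hasymp : Summable (fun n : ℤ => ‖lam n - ((π : ℂ) * (n : ℤ) + p₀)‖ ^ 2)) :
    Summable (fun n : ℤ =>
      ∫ x in (0:ℝ)..1,
        (‖Complex.cos (lam n * x) - Complex.cos (((π : ℂ) * (n : ℤ) + p₀) * x)‖ ^ 2 +
         ‖Complex.sin (lam n * x) - Complex.sin (((π : ℂ) * (n : ℤ) + p₀) * x)‖ ^ 2)) := by
  set S := ∑' n : ℤ, ‖lam n - ((π : ℂ) * (n : ℤ) + p₀)‖ ^ 2
  have hS : ∀ n : ℤ, ‖lam n - ((π : ℂ) * (n : ℤ) + p₀)‖ ≤ √S := fun n =>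
    Real.le_sqrt_of_sq_le (hasymp.le_tsum n fun _ _ => by positivity)
  refine Summable.of_nonneg_of_le (fun n => ?_) (fun n => ?_)
    (hasymp.mul_left (2 * (Real.exp |p₀.im| * Real.exp √S) ^ 2))
  · exact intervalIntegral.integral_nonneg zero_le_one fun x _ => by positivity
  · refine (integral_cos_sin_sub_sq_le _ _).trans ?_
    have him : ((π : ℂ) * (n : ℤ) + p₀).im = p₀.im := by simp
    rw [him, mul_assoc, ← mul_pow]
    calc 2 * (Real.exp |p₀.im| * (‖lam n - ((π : ℂ) * (n : ℤ) + p₀)‖ *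
          Real.exp ‖lam n - ((π : ℂ) * (n : ℤ) + p₀)‖)) ^ 2
        ≤ 2 * (Real.exp |p₀.im| * (‖lam n - ((π : ℂ) * (n : ℤ) + p₀)‖ * Real.exp √S)) ^ 2 := by
          gcongr
          exact hS n
      _ = _ := by ring
end

section
/- Let p₀ be a real number. Then the family of functions vₙ(x) = (cos((πn + p₀)x), sin((πn + p₀)x))ᵗ, n ∈ ℤ, forms an orthonormal basis (a complete orthonormal system) of the Hilbert space L²((0,1);ℂ²). -/
open MeasureTheory Set Real

theorem integral_neg_one_one_eq_integral_add_comp_neg {E : Type*} [NormedAddCommGroup E]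
    [NormedSpace ℝ E] {F : ℝ → E} (hF : IntervalIntegrable F volume (-1) 1) :
    ∫ x in (-1 : ℝ)..1, F x = ∫ x in (0 : ℝ)..1, (F x + F (-x)) := by
  have h0 : IntervalIntegrable F volume (-1) 0 :=
    hF.mono_set (by rw [uIcc_of_le (by norm_num), uIcc_of_le (by norm_num)]; gcongr; norm_num)
  have h1 : IntervalIntegrable F volume 0 1 :=
    hF.mono_set (by rw [uIcc_of_le (by norm_num), uIcc_of_le (by norm_num)]; gcongr; norm_num)
  have h2 : IntervalIntegrable (fun x => F (-x)) volume 0 1 := by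
    simpa using ((IntervalIntegrable.iff_comp_neg (f := F)).1 h0).symm
  rw [intervalIntegral.integral_add h1 h2, intervalIntegral.integral_comp_neg, neg_zero, add_comm,
    intervalIntegral.integral_add_adjacent_intervals h0 h1]

/-- Glue `u` on `(0, 1]` and the reflection of `w` on `[-1, 0)`, extending by zero elsewhere. -/
noncomputable def reflectGlue (u w : ℝ → ℂ) (x : ℝ) : ℂ :=
  (Ioc (0 : ℝ) 1).indicator u x + (Ioc (0 : ℝ) 1).indicator w (-x)

theorem reflectGlue_of_mem {u w : ℝ → ℂ} {x : ℝ} (hx : x ∈ Ioc (0 : ℝ) 1) :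
    reflectGlue u w x = u x := by
  have h : -x ∉ Ioc (0 : ℝ) 1 := fun h => by linarith [hx.1, h.1]
  simp only [reflectGlue, indicator_of_mem hx, indicator_of_notMem h, add_zero]

theorem reflectGlue_neg_of_mem {u w : ℝ → ℂ} {x : ℝ} (hx : x ∈ Ioc (0 : ℝ) 1) :
    reflectGlue u w (-x) = w x := by
  have h : -x ∉ Ioc (0 : ℝ) 1 := fun h => by linarith [hx.1, h.1]
  simp only [reflectGlue, neg_neg, indicator_of_mem hx, indicator_of_notMem h, zero_add]

theorem memLp_reflectGlue {u w : ℝ → ℂ} (hu : MemLp u 2 (volume.restrict (Ioc (0 : ℝ) 1)))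
    (hw : MemLp w 2 (volume.restrict (Ioc (0 : ℝ) 1))) : MemLp (reflectGlue u w) 2 volume :=
  ((memLp_indicator_iff_restrict measurableSet_Ioc).2 hu).add
    (((memLp_indicator_iff_restrict measurableSet_Ioc).2 hw).comp_measurePreserving
      (Measure.measurePreserving_neg volume))

theorem MeasureTheory.MemLp.unimodular_mul {α : Type*} [MeasurableSpace α] {μ : Measure α}
    {p : ENNReal} {c h : α → ℂ} (hh : MemLp h p μ) (hc : AEStronglyMeasurable c μ)
    (hc1 : ∀ x, ‖c x‖ = 1) : MemLp (fun x => c x * h x) p μ :=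
  hh.of_le (hc.mul hh.1) (.of_forall fun x => by simp [hc1])

/-- Parseval: a pair of functions orthogonal to every shifted trigonometric pair vanishes. -/
theorem integral_norm_sq_eq_zero_of_orthogonal (p : ℝ) {f g : ℝ → ℂ}
    (hf : MemLp f 2 (volume.restrict (Ioc (0 : ℝ) 1)))
    (hg : MemLp g 2 (volume.restrict (Ioc (0 : ℝ) 1)))
    (horth : ∀ n : ℤ, ∫ x in (0 : ℝ)..1, (Complex.cos (((π * n + p : ℝ) : ℂ) * x) * f x +
      Complex.sin (((π * n + p : ℝ) : ℂ) * x) * g x) = 0) :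
    ∫ x in (0 : ℝ)..1, (‖f x‖ ^ 2 + ‖g x‖ ^ 2) = 0 := by
  set h : ℝ → ℂ := reflectGlue (fun x => f x - Complex.I * g x) (fun x => f x + Complex.I * g x)
  have hh : MemLp h 2 volume :=
    memLp_reflectGlue (hf.sub (hg.const_mul _)) (hf.add (hg.const_mul _))
  have hpos : ∀ x ∈ Ioc (0 : ℝ) 1, h x = f x - Complex.I * g x := fun x hx =>
    reflectGlue_of_mem hx
  have hneg : ∀ x ∈ Ioc (0 : ℝ) 1, h (-x) = f x + Complex.I * g x := fun x hx =>
    reflectGlue_neg_of_mem hx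
  have hmem : ∀ a : ℝ, MemLp (fun x : ℝ => Complex.exp ((a * x : ℝ) * Complex.I) * h x) 2
      (volume.restrict (Ioc (-1 : ℝ) 1)) := fun a =>
    (hh.restrict _).unimodular_mul (Continuous.aestronglyMeasurable (by fun_prop))
      fun x => Complex.norm_exp_ofReal_mul_I _
  have hcoeff : ∀ n : ℤ, fourierCoeffOn (by norm_num : (-1 : ℝ) < 1)
      (fun x : ℝ => Complex.exp ((p * x : ℝ) * Complex.I) * h x) n = 0 := by
    intro n
    have hint : IntervalIntegrable
        (fun x : ℝ => Complex.exp (((π * (-n : ℤ) + p) * x : ℝ) * Complex.I) * h x)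
        volume (-1) 1 :=
      (intervalIntegrable_iff_integrableOn_Ioc_of_le (by norm_num)).2
        ((hmem _).integrable (by norm_num))
    have key : ∫ x in (-1 : ℝ)..1,
        Complex.exp (((π * (-n : ℤ) + p) * x : ℝ) * Complex.I) * h x = 0 := by
      rw [integral_neg_one_one_eq_integral_add_comp_neg hint,
        ← mul_zero (2 : ℂ), ← horth (-n), ← intervalIntegral.integral_const_mul]
      refine intervalIntegral.integral_congr_ae (.of_forall fun x hx => ?_)
      rw [uIoc_of_le zero_le_one] at hx
      rw [hpos x hx, hneg x hx, mul_neg, Complex.ofReal_neg, Complex.ofReal_mul, neg_mul,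
        Complex.cos, Complex.sin, neg_mul]
      ring
    rw [fourierCoeffOn_eq_integral]
    convert smul_zero _
    rw [← key]
    congr 1 with x
    rw [fourier_coe_apply, smul_eq_mul, ← mul_assoc, ← Complex.exp_add]
    congr 2
    push_cast
    ring
  have hparseval := hasSum_sq_fourierCoeffOn (by norm_num : (-1 : ℝ) < 1) (hmem p)
  simp only [hcoeff, norm_zero, norm_mul, Complex.norm_exp_ofReal_mul_I, one_mul] at hparseval
  have hint : IntervalIntegrable (fun x => ‖h x‖ ^ 2) volume (-1) 1 :=
    ((memLp_two_iff_integrable_sq_norm hh.1).1 hh).intervalIntegrable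
  have hzero : ∫ x in (-1 : ℝ)..1, ‖h x‖ ^ 2 = 0 := by
    simpa using hparseval.tsum_eq.symm
  rw [integral_neg_one_one_eq_integral_add_comp_neg hint] at hzero
  have hdouble : ∫ x in (0 : ℝ)..1, (‖h x‖ ^ 2 + ‖h (-x)‖ ^ 2) =
      ∫ x in (0 : ℝ)..1, 2 * (‖f x‖ ^ 2 + ‖g x‖ ^ 2) := by
    refine intervalIntegral.integral_congr_ae (.of_forall fun x hx => ?_)
    rw [uIoc_of_le zero_le_one] at hx
    have := parallelogram_law_with_norm ℝ (f x) (Complex.I * g x)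
    rw [norm_mul, Complex.norm_I] at this
    rw [hpos x hx, hneg x hx]
    linarith
  rw [hdouble, intervalIntegral.integral_const_mul] at hzero
  linarith

/-- The function `x ↦ (cos (a x), sin (a x))`, with values in `ℂ²`. -/
noncomputable def cosSin (a : ℝ) (x : ℝ) : EuclideanSpace ℂ (Fin 2) :=
  !₂[Complex.cos (a * x), Complex.sin (a * x)]

theorem inner_cosSin (a x : ℝ) (y : EuclideanSpace ℂ (Fin 2)) :
    inner ℂ (cosSin a x) y = Complex.cos (a * x) * y 0 + Complex.sin (a * x) * y 1 := by
  simp [cosSin, PiLp.inner_apply, Fin.sum_univ_two, ← Complex.cos_conj, ← Complex.sin_conj,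
    mul_comm]

theorem inner_cosSin_cosSin (a b x : ℝ) :
    inner ℂ (cosSin a x) (cosSin b x) = Complex.cos ((a - b : ℝ) * x) := by
  rw [inner_cosSin, Complex.ofReal_sub, sub_mul, Complex.cos_sub]
  rfl

theorem continuous_cosSin (a : ℝ) : Continuous (cosSin a) := by
  refine (PiLp.continuous_toLp 2 _).comp (continuous_pi fun i => ?_)
  fin_cases i <;> simp <;> fun_prop

theorem norm_cosSin (a x : ℝ) : ‖cosSin a x‖ = 1 := by
  have h : (‖cosSin a x‖ : ℂ) ^ 2 = 1 := by
    have := inner_self_eq_norm_sq_to_K (𝕜 := ℂ) (cosSin a x)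
    rw [inner_cosSin_cosSin] at this
    simpa using this.symm
  have h' : ‖cosSin a x‖ ^ 2 = 1 := by exact_mod_cast h
  exact (pow_eq_one_iff_of_nonneg (norm_nonneg _) two_ne_zero).1 h'

theorem memLp_cosSin (a : ℝ) : MemLp (cosSin a) 2 (volume.restrict (Ioc (0 : ℝ) 1)) :=
  .of_bound (continuous_cosSin a).aestronglyMeasurable 1 (.of_forall fun x => (norm_cosSin a x).le)

theorem integral_cos_pi_int_mul (k : ℤ) :
    ∫ x in (0 : ℝ)..1, Complex.cos ((π * k : ℝ) * x) = if k = 0 then 1 else 0 := by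
  split_ifs with hk
  · simp [hk]
  · have h : ((π * k : ℝ) : ℂ) ≠ 0 := by
      exact_mod_cast mul_ne_zero pi_ne_zero (Int.cast_ne_zero.2 hk)
    rw [integral_cos_mul_complex h]
    simp [mul_comm (π : ℂ), Complex.sin_int_mul_pi]

theorem inner_toLp_cosSin (a : ℝ)
    (F : Lp (EuclideanSpace ℂ (Fin 2)) 2 (volume.restrict (Ioc (0 : ℝ) 1))) :
    inner ℂ (memLp_cosSin a).toLp F = ∫ x in (0 : ℝ)..1, inner ℂ (cosSin a x) (F x) := by
  rw [L2.inner_def, intervalIntegral.integral_of_le zero_le_one]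
  refine integral_congr_ae ?_
  filter_upwards [(memLp_cosSin a).coeFn_toLp] with x hx
  rw [hx]

theorem orthonormal_toLp_cosSin (p : ℝ) :
    Orthonormal ℂ fun n : ℤ => (memLp_cosSin (π * n + p)).toLp := by
  rw [orthonormal_iff_ite]
  intro m n
  rw [inner_toLp_cosSin, intervalIntegral.integral_of_le zero_le_one]
  have h := integral_cos_pi_int_mul (m - n)
  rw [intervalIntegral.integral_of_le zero_le_one] at h
  simp only [sub_eq_zero] at h
  rw [← h]
  refine integral_congr_ae ?_
  filter_upwards [(memLp_cosSin (π * n + p)).coeFn_toLp] with x hx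
  rw [hx, inner_cosSin_cosSin]
  congr 3
  push_cast
  ring

theorem eq_zero_of_inner_toLp_cosSin_eq_zero (p : ℝ)
    (F : Lp (EuclideanSpace ℂ (Fin 2)) 2 (volume.restrict (Ioc (0 : ℝ) 1)))
    (hF : ∀ n : ℤ, inner ℂ (memLp_cosSin (π * n + p)).toLp F = 0) : F = 0 := by
  have h := integral_norm_sq_eq_zero_of_orthogonal p ((Lp.memLp F).eval_piLp 0)
    ((Lp.memLp F).eval_piLp 1) fun n => by
      simpa only [inner_toLp_cosSin, inner_cosSin] using hF n
  rw [← inner_self_eq_zero (𝕜 := ℂ), L2.inner_def]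
  refine Eq.trans ?_ (congrArg Complex.ofReal h)
  rw [← intervalIntegral.integral_ofReal, intervalIntegral.integral_of_le zero_le_one]
  congr 1 with x
  rw [inner_self_eq_norm_sq_to_K, ← Fin.sum_univ_two fun i => ‖F x i‖ ^ 2,
    ← EuclideanSpace.norm_sq_eq]
  simp

/-- For real `p₀`, the family `vₙ(x) = (cos((πn+p₀)x), sin((πn+p₀)x))ᵗ`, `n ∈ ℤ`, is an
orthonormal basis (a complete orthonormal system) of `L²((0,1);ℂ²)`: realized as elements
`V n` of the Lebesgue space `L²` with the indicated a.e. representatives, the family is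
orthonormal and its linear span is dense. -/
theorem trig_system_orthonormal_basis (p₀ : ℝ) :
    ∃ V : ℤ → Lp (EuclideanSpace ℂ (Fin 2)) 2 (volume.restrict (Ioc (0:ℝ) 1)),
      (∀ n : ℤ, ∀ᵐ x ∂(volume.restrict (Ioc (0:ℝ) 1)),
        (V n : ℝ → EuclideanSpace ℂ (Fin 2)) x =
          ![Complex.cos (((π * n + p₀ : ℝ) : ℂ) * x),
            Complex.sin (((π * n + p₀ : ℝ) : ℂ) * x)]) ∧
      Orthonormal ℂ V ∧
      (Submodule.span ℂ (Set.range V)).topologicalClosure = ⊤ := by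
  refine ⟨fun n => (memLp_cosSin (π * n + p₀)).toLp, fun n => ?_, orthonormal_toLp_cosSin p₀, ?_⟩
  · filter_upwards [(memLp_cosSin (π * n + p₀)).coeFn_toLp] with x hx
    rw [hx]
    rfl
  · rw [Submodule.topologicalClosure_eq_top_iff, Submodule.eq_bot_iff]
    intro F hF
    exact eq_zero_of_inner_toLp_cosSin_eq_zero p₀ F fun n =>
      (Submodule.mem_orthogonal _ _).1 hF _ (Submodule.subset_span ⟨n, rfl⟩)
end
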